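/- arXiv:1310.5400 — 9 statements merged into one kernel-verified Lean document; each statement's English description precedes it below -/
import Mathlib

section
/- Let k ≥ 2 be an integer, let p ∈ [2/3, 1), and let n ≥ max(4k² − 4k + 3, (k² − 1)/(1 − p) + 2). Let C_1, ..., C_r be pairwise disjoint families of k-element subsets of {1,...,n} such that for all i ≠ j, every set in C_i intersects every set in C_j, and such that |C_i| ≤ p·(|C_1| + ... + |C_r|) for every i. Then |C_1| + ... + |C_r| ≤ C(n−1, k−1). -/
open Finset FinsetFamily in
/-- If `F` is a family of `k`-sets avoiding `x`, cross-intersecting with a family `G` of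
`k`-sets containing `x`, then a large `F` forces a small `G`. -/
theorem card_add_choose_le_of_cross_intersecting {n k s : ℕ} {F G : Finset (Finset (Fin n))}
    {x : Fin n} (hs1 : 1 ≤ s) (hsk : s ≤ k) (hn : 2 * k ≤ n)
    (hFk : ∀ S ∈ F, #S = k) (hFx : ∀ S ∈ F, x ∉ S)
    (hGk : ∀ T ∈ G, #T = k) (hGx : ∀ T ∈ G, x ∈ T)
    (hcross : ∀ S ∈ F, ∀ T ∈ G, (S ∩ T).Nonempty)
    (hF : (n - 1 - s).choose (k - s) ≤ #F) :
    #G + (n - 1 - s).choose (k - 1) ≤ (n - 1).choose (k - 1) := by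
  set F' : Finset (Finset (Fin n)) := F.image fun S ↦ (insert x S)ᶜ with hF'
  set G' : Finset (Finset (Fin n)) := G.image fun T ↦ T.erase x with hG'
  have hF'card : #F' = #F := by
    refine card_image_of_injOn fun S hS T hT h ↦ ?_
    have h' : insert x S = insert x T := compl_injective h
    rw [← erase_insert (hFx S hS), ← erase_insert (hFx T hT), h']
  have hG'card : #G' = #G := by
    refine card_image_of_injOn fun S hS T hT h ↦ ?_
    have h' : S.erase x = T.erase x := h
    rw [← insert_erase (hGx S hS), ← insert_erase (hGx T hT), h']
  have hsized : (F' : Set (Finset (Fin n))).Sized (n - 1 - k) := by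
    intro U hU
    obtain ⟨S, hS, rfl⟩ := mem_image.1 (mem_coe.1 hU)
    rw [card_compl, card_insert_of_notMem (hFx S hS), hFk S hS, Fintype.card_fin]
    omega
  have hshadow : (n - 1 - s).choose (k - 1) ≤ #(∂^[n - 2 * k] F') := by
    have h := kruskal_katona_lovasz_form (i := n - 2 * k) (k := n - 1 - s) (by omega) (by omega)
      (by omega) hsized (by
        rw [hF'card, ← Nat.choose_symm_of_eq_add (show n - 1 - s = (k - s) + (n - 1 - k) by omega)]
        exact hF)
    rwa [show n - 1 - k - (n - 2 * k) = k - 1 by omega] at h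
  have hdisj : Disjoint G' (∂^[n - 2 * k] F') := by
    rw [disjoint_left]
    intro U hU hU'
    obtain ⟨T, hT, rfl⟩ := mem_image.1 hU
    obtain ⟨V, hV, hUV, -⟩ := mem_shadow_iterate_iff_exists_mem_card_add.1 hU'
    obtain ⟨S, hS, rfl⟩ := mem_image.1 hV
    obtain ⟨y, hy⟩ := hcross S hS T hT
    rw [mem_inter] at hy
    have hyx : y ≠ x := fun h ↦ hFx S hS (h ▸ hy.1)
    exact mem_compl.1 (hUV (mem_erase.2 ⟨hyx, hy.2⟩)) (mem_insert_of_mem hy.1)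
  have hsub : G' ∪ ∂^[n - 2 * k] F' ⊆ powersetCard (k - 1) (univ.erase x) := by
    intro U hU
    rw [mem_powersetCard, subset_erase]
    rcases mem_union.1 hU with hU | hU
    · obtain ⟨T, hT, rfl⟩ := mem_image.1 hU
      exact ⟨⟨subset_univ _, notMem_erase _ _⟩, by rw [card_erase_of_mem (hGx T hT), hGk T hT]⟩
    · refine ⟨⟨subset_univ _, fun hx ↦ ?_⟩, ?_⟩
      · obtain ⟨V, hV, hUV, -⟩ := mem_shadow_iterate_iff_exists_mem_card_add.1 hU
        obtain ⟨S, hS, rfl⟩ := mem_image.1 hV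
        exact mem_compl.1 (hUV hx) (mem_insert_self _ _)
      · rw [hsized.shadow_iterate (mem_coe.2 hU)]
        omega
  have hcard := card_le_card hsub
  rw [card_union_of_disjoint hdisj, card_powersetCard, card_erase_of_mem (mem_univ _), card_univ,
    Fintype.card_fin, hG'card] at hcard
  omega

theorem Nat.choose_add_succ_le (m s j : ℕ) :
    (m + s).choose (j + 1) ≤ s * (m + s - 1).choose j + m.choose (j + 1) := by
  induction s with
  | zero => simp
  | succ s ih =>
    have hmono : (m + s - 1).choose j ≤ (m + s).choose j := Nat.choose_le_choose j (by omega)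
    have := Nat.mul_le_mul_left s hmono
    rw [← Nat.add_assoc, Nat.choose_succ_succ, Nat.add_sub_cancel, Nat.succ_mul]
    simp only [Nat.succ_eq_add_one]
    omega

open Finset in
theorem card_le_mul_choose_of_cross_intersecting {n k s : ℕ} {A B : Finset (Finset (Fin n))}
    (x : Fin n) (hk : 2 ≤ k) (hs1 : 1 ≤ s) (hsk : s ≤ k) (hn : 2 * k ≤ n)
    (hA : ∀ S ∈ A, #S = k) (hB : ∀ T ∈ B, #T = k)
    (hcross : ∀ S ∈ A, ∀ T ∈ B, (S ∩ T).Nonempty)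
    (hF : (n - 1 - s).choose (k - s) ≤ #{S ∈ A | x ∉ S}) :
    #{T ∈ B | x ∈ T} ≤ s * (n - 2).choose (k - 2) := by
  have h := card_add_choose_le_of_cross_intersecting (F := {S ∈ A | x ∉ S})
    (G := {T ∈ B | x ∈ T}) hs1 hsk hn
    (fun S hS ↦ hA S (mem_filter.1 hS).1) (fun S hS ↦ (mem_filter.1 hS).2)
    (fun S hS ↦ hB S (mem_filter.1 hS).1) (fun S hS ↦ (mem_filter.1 hS).2)
    (fun S hS T hT ↦ hcross S (mem_filter.1 hS).1 T (mem_filter.1 hT).1) hF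
  have h' := Nat.choose_add_succ_le (n - 1 - s) s (k - 2)
  rw [show n - 1 - s + s = n - 1 by omega, show k - 2 + 1 = k - 1 by omega,
    show n - 1 - 1 = n - 2 by omega] at h'
  omega

open Finset in
/-- Two cross-intersecting families of `k`-sets, both large, are stars with the same centre. -/
theorem exists_common_mem_of_cross_intersecting {n k : ℕ} {A B : Finset (Finset (Fin n))}
    (hk : 2 ≤ k) (hn : 2 * k ≤ n)
    (hA : ∀ S ∈ A, #S = k) (hB : ∀ T ∈ B, #T = k)
    (hcross : ∀ S ∈ A, ∀ T ∈ B, (S ∩ T).Nonempty)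
    (hAcard : 2 * k * (n - 2).choose (k - 2) < #A)
    (hBcard : (k + 1) * (n - 2).choose (k - 2) < #B) :
    ∃ x, (∀ S ∈ A, x ∈ S) ∧ ∀ T ∈ B, x ∈ T := by
  by_contra! hstar
  set N := (n - 2).choose (k - 2) with hN
  have hcross' : ∀ T ∈ B, ∀ S ∈ A, (T ∩ S).Nonempty := fun T hT S hS ↦ by
    rw [inter_comm]; exact hcross S hS T hT
  have hsplitA (x : Fin n) : #{S ∈ A | x ∈ S} + #{S ∈ A | x ∉ S} = #A :=
    card_filter_add_card_filter_not _
  have hsplitB (x : Fin n) : #{S ∈ B | x ∈ S} + #{S ∈ B | x ∉ S} = #B :=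
    card_filter_add_card_filter_not _
  have hkN : k * N ≤ 2 * k * N ∧ k * N ≤ (k + 1) * N ∧ 2 * N ≤ k * N ∧
      (k + 1) * N = k * N + N ∧ 2 * k * N = k * N + k * N := by
    refine ⟨?_, ?_, Nat.mul_le_mul_right _ hk, by ring, by ring⟩ <;>
      exact Nat.mul_le_mul_right _ (by omega)
  have hBk (x : Fin n) (h : 1 ≤ #{S ∈ A | x ∉ S}) : #{T ∈ B | x ∈ T} ≤ k * N :=
    card_le_mul_choose_of_cross_intersecting x hk (by omega) le_rfl hn hA hB hcross (by simpa using h)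
  have hAk (x : Fin n) (h : 1 ≤ #{S ∈ B | x ∉ S}) : #{T ∈ A | x ∈ T} ≤ k * N :=
    card_le_mul_choose_of_cross_intersecting x hk (by omega) le_rfl hn hB hA hcross' (by simpa using h)
  have hNmono : (n - 1 - 2).choose (k - 2) ≤ N := Nat.choose_le_choose _ (by omega)
  have hAne (x : Fin n) : 1 ≤ #{S ∈ A | x ∉ S} := by
    by_contra h
    have hall : ∀ S ∈ A, x ∈ S := fun S hS ↦ by
      by_contra hx
      exact h (card_pos.2 ⟨S, mem_filter.2 ⟨hS, hx⟩⟩)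
    obtain ⟨T, hT, hxT⟩ := hstar x hall
    have := hAk x (card_pos.2 ⟨T, mem_filter.2 ⟨hT, hxT⟩⟩)
    have := hsplitA x
    omega
  have hBne (x : Fin n) : 1 ≤ #{S ∈ B | x ∉ S} := by
    have := hBk x (hAne x)
    have := hsplitB x
    omega
  have hB2 (x : Fin n) : #{T ∈ B | x ∈ T} ≤ 2 * N := by
    refine card_le_mul_choose_of_cross_intersecting x hk (by omega) hk hn hA hB hcross ?_
    have := hAk x (hBne x)
    have := hsplitA x
    omega
  have hA2 (x : Fin n) : #{T ∈ A | x ∈ T} ≤ 2 * N := by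
    refine card_le_mul_choose_of_cross_intersecting x hk (by omega) hk hn hB hA hcross' ?_
    have := hB2 x
    have := hsplitB x
    omega
  obtain ⟨T, hT⟩ : B.Nonempty := card_pos.1 (by omega)
  have hcover : A ⊆ T.biUnion fun x ↦ {S ∈ A | x ∈ S} := fun S hS ↦ by
    obtain ⟨x, hx⟩ := hcross S hS T hT
    rw [mem_inter] at hx
    exact mem_biUnion.2 ⟨x, hx.2, mem_filter.2 ⟨hS, hx.1⟩⟩
  have := (card_le_card hcover).trans (card_biUnion_le_card_mul _ _ _ fun x _ ↦ hA2 x)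
  rw [hB T hT] at this
  have : k * (2 * N) = 2 * k * N := by ring
  omega

open Finset in
theorem card_le_choose_of_forall_mem {n k : ℕ} {F : Finset (Finset (Fin n))} {x : Fin n}
    (hF : ∀ S ∈ F, #S = k) (hx : ∀ S ∈ F, x ∈ S) : #F ≤ (n - 1).choose (k - 1) := by
  have hinj : Set.InjOn (fun S : Finset (Fin n) ↦ S.erase x) F := fun S hS T hT h ↦ by
    have h' : S.erase x = T.erase x := h
    rw [← insert_erase (hx S hS), ← insert_erase (hx T hT), h']
  have hsub : F.image (fun S ↦ S.erase x) ⊆ powersetCard (k - 1) (univ.erase x) := by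
    intro U hU
    obtain ⟨S, hS, rfl⟩ := mem_image.1 hU
    exact mem_powersetCard.2
      ⟨erase_subset_erase _ (subset_univ _), by rw [card_erase_of_mem (hx S hS), hF S hS]⟩
  have hcard := card_le_card hsub
  rwa [card_image_of_injOn hinj, card_powersetCard, card_erase_of_mem (mem_univ _), card_univ,
    Fintype.card_fin] at hcard

open Finset in
/-- The bipartite case, for families in `Fin n`. -/
theorem card_add_card_le_choose_of_cross_intersecting {n k : ℕ} {p : ℝ}
    {A B : Finset (Finset (Fin n))} (hk : 2 ≤ k) (hp1 : p < 1)
    (hn1 : 4 * k ^ 2 - 4 * k + 3 ≤ n) (hn2 : ((k : ℝ) ^ 2 - 1) / (1 - p) + 2 ≤ (n : ℝ))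
    (hA : ∀ S ∈ A, #S = k) (hB : ∀ T ∈ B, #T = k) (hdisj : Disjoint A B)
    (hcross : ∀ S ∈ A, ∀ T ∈ B, (S ∩ T).Nonempty)
    (hAp : (#A : ℝ) ≤ p * (#A + #B : ℕ)) (hBp : (#B : ℝ) ≤ p * (#A + #B : ℕ)) :
    #A + #B ≤ (n - 1).choose (k - 1) := by
  wlog hAB : #B ≤ #A generalizing A B
  · rw [add_comm]
    refine this hB hA hdisj.symm (fun S hS T hT ↦ ?_) ?_ ?_ (by omega)
    · rw [inter_comm]; exact hcross T hT S hS
    · rwa [add_comm]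
    · rwa [add_comm]
  by_contra! hlarge
  obtain ⟨j, rfl⟩ := Nat.exists_eq_add_of_le' hk
  have hn3 : 4 * (j + 2) * (j + 1) + 3 ≤ n := by
    have : 4 * (j + 2) ^ 2 - 4 * (j + 2) = 4 * (j + 2) * (j + 1) := by
      rw [Nat.sub_eq_iff_eq_add (by nlinarith)]; ring
    omega
  obtain ⟨m, rfl⟩ : ∃ m, n = m + 2 := ⟨n - 2, by omega⟩
  have hchoose : (m + 1) * m.choose j = (m + 1).choose (j + 1) * (j + 1) :=
    Nat.add_one_mul_choose_eq m j
  have hlarge' : (m + 1).choose (j + 1) < #A + #B := hlarge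
  have hNpos : 0 < m.choose j := Nat.choose_pos (by nlinarith)
  have hAcard : 2 * (j + 2) * m.choose j < #A := by
    have h4 : 4 * (j + 2) * m.choose j ≤ (m + 1).choose (j + 1) := by
      refine Nat.le_of_mul_le_mul_right (c := j + 1) ?_ (by omega)
      rw [← hchoose]
      nlinarith
    have : 4 * (j + 2) * m.choose j = 2 * (2 * (j + 2) * m.choose j) := by ring
    omega
  have hBcard : (j + 2 + 1) * m.choose j < #B := by
    have hq : 0 < 1 - p := by linarith
    have hn4 : ((j : ℝ) + 2) ^ 2 - 1 ≤ (1 - p) * m := by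
      have : (((j + 2 : ℕ) : ℝ) ^ 2 - 1) / (1 - p) ≤ m := by push_cast at hn2 ⊢; linarith
      rw [div_le_iff₀ hq] at this
      push_cast at this
      linarith
    have hB' : (1 - p) * (#A + #B : ℝ) ≤ #B := by push_cast at hAp; linarith
    have hlargeR : ((m + 1).choose (j + 1) : ℝ) < #A + #B := by exact_mod_cast hlarge'
    have hchooseR : ((m : ℝ) + 1) * m.choose j = (m + 1).choose (j + 1) * (j + 1) := by
      exact_mod_cast hchoose
    have hNR : (0 : ℝ) < m.choose j := by exact_mod_cast hNpos
    have h1 : ((j : ℝ) + 1) * ((j + 3) * m.choose j) ≤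
        (j + 1) * ((1 - p) * (m + 1).choose (j + 1)) :=
      calc ((j : ℝ) + 1) * ((j + 3) * m.choose j) = (((j : ℝ) + 2) ^ 2 - 1) * m.choose j := by ring
        _ ≤ ((1 - p) * (m + 1)) * m.choose j := by gcongr; linarith
        _ = (1 - p) * ((m + 1) * m.choose j) := by ring
        _ = _ := by rw [hchooseR]; ring
    have h2 := le_of_mul_le_mul_left h1 (by positivity)
    have h3 := mul_lt_mul_of_pos_left hlargeR hq
    have : ((j : ℝ) + 3) * m.choose j < #B := by linarith
    exact_mod_cast this
  obtain ⟨x, hxA, hxB⟩ := exists_common_mem_of_cross_intersecting hk (by nlinarith) hA hB hcross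
    hAcard hBcard
  have := card_le_choose_of_forall_mem (F := A ∪ B) (k := j + 2) (x := x)
    (fun S hS ↦ (mem_union.1 hS).elim (hA S) (hB S))
    (fun S hS ↦ (mem_union.1 hS).elim (hxA S) (hxB S))
  rw [card_union_of_disjoint hdisj] at this
  omega

open Finset in
/-- Weights none of which exceeds a fraction `p ≥ 2 / 3` of the total can be split into two parts
with the same property. -/
theorem exists_balanced_split {ι : Type*} [Fintype ι] [DecidableEq ι] (c : ι → ℕ) {p : ℝ}
    (hp : 2 / 3 ≤ p) (hc : ∀ i, (c i : ℝ) ≤ p * (∑ j, c j : ℕ)) :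
    ∃ S : Finset ι, ((∑ i ∈ S, c i : ℕ) : ℝ) ≤ p * (∑ j, c j : ℕ) ∧
      ((∑ i ∈ Sᶜ, c i : ℕ) : ℝ) ≤ p * (∑ j, c j : ℕ) := by
  set m := ∑ j, c j with hm
  have hsmall (a : ℕ) (ha : 3 * a ≤ 2 * m) : (a : ℝ) ≤ p * m := by
    have : (3 : ℝ) * a ≤ 2 * m := by exact_mod_cast ha
    have : 2 / 3 * (m : ℝ) ≤ p * m := by gcongr
    linarith
  have hcompl (S : Finset ι) : ∑ i ∈ S, c i + ∑ i ∈ Sᶜ, c i = m := sum_add_sum_compl S c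
  by_cases hbig : ∃ i, m ≤ 3 * c i
  · obtain ⟨i, hi⟩ := hbig
    refine ⟨{i}, by simpa using hc i, hsmall _ ?_⟩
    have := hcompl {i}
    rw [sum_singleton] at this
    omega
  · push Not at hbig
    obtain ⟨S, hS⟩ := exists_minimal (s := {S : Finset ι | m ≤ 3 * ∑ i ∈ S, c i})
      ⟨univ, by simp [← hm]; omega⟩
    have hSm : m ≤ 3 * ∑ i ∈ S, c i := by simpa using hS.prop
    refine ⟨S, hsmall _ ?_, hsmall _ ?_⟩
    · rcases S.eq_empty_or_nonempty with rfl | ⟨i, hi⟩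
      · simp
      · have herase : 3 * ∑ j ∈ S.erase i, c j < m := by
          by_contra! h
          exact notMem_erase i S (hS.le_of_le (by simpa using h) (erase_subset i S) hi)
        have := add_sum_erase S c hi
        have := hbig i
        omega
    · have := hcompl S
      omega

open Finset in
theorem exists_injOn_finset_fin (n : ℕ) :
    ∃ D : Finset ℕ → Finset (Fin n), Set.InjOn D {s | s ⊆ Icc 1 n} ∧
      (∀ s ⊆ Icc 1 n, #(D s) = #s) ∧
      ∀ s ⊆ Icc 1 n, ∀ t, (s ∩ t).Nonempty → (D s ∩ D t).Nonempty := by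
  let e : Fin n ↪ ℕ := ⟨fun i ↦ i + 1, fun i j h ↦ Fin.ext (Nat.succ_injective h)⟩
  have hmap (s : Finset ℕ) (hs : s ⊆ Icc 1 n) :
      ({i : Fin n | (i : ℕ) + 1 ∈ s} : Finset (Fin n)).map e = s := by
    ext a
    simp only [mem_map, mem_filter, mem_univ, true_and]
    refine ⟨fun ⟨i, hi, hia⟩ ↦ hia ▸ hi, fun ha ↦ ?_⟩
    have := mem_Icc.1 (hs ha)
    have ha' : a - 1 + 1 = a := by omega
    exact ⟨⟨a - 1, by omega⟩, by simpa only [ha'] using ha, ha'⟩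
  refine ⟨fun s ↦ {i | (i : ℕ) + 1 ∈ s}, fun s hs t ht h ↦ ?_, fun s hs ↦ ?_, ?_⟩
  · rw [← hmap s hs, ← hmap t ht]
    exact congrArg _ h
  · conv_rhs => rw [← hmap s hs, card_map]
  · rintro s hs t ⟨a, ha⟩
    rw [mem_inter] at ha
    have := mem_Icc.1 (hs ha.1)
    have ha' : a - 1 + 1 = a := by omega
    exact ⟨⟨a - 1, by omega⟩, by simpa [ha'] using ha⟩


/-- Multipartite Erdős–Ko–Rado: let `k ≥ 2`, `p ∈ [2/3,1)` and
`n ≥ max(4k² - 4k + 3, (k² - 1)/(1-p) + 2)`. If `C 1, ..., C r` are pairwise disjoint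
families of `k`-element subsets of `{1,...,n}` such that sets from different families
always intersect, and no family contains more than a `p`-fraction of all the sets, then
there are at most `C(n-1,k-1)` sets in total. -/
theorem multipartite_EKR (n k r : ℕ) (p : ℝ) (hk : 2 ≤ k)
    (hp : 2 / 3 ≤ p) (hp1 : p < 1)
    (hn1 : 4 * k ^ 2 - 4 * k + 3 ≤ n) (hn2 : ((k : ℝ) ^ 2 - 1) / (1 - p) + 2 ≤ (n : ℝ))
    (C : Fin r → Finset (Finset ℕ))
    (hmem : ∀ i, ∀ s ∈ C i, s ⊆ Finset.Icc 1 n ∧ s.card = k)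
    (hdisj : ∀ i j, i ≠ j → Disjoint (C i) (C j))
    (hcross : ∀ i j, i ≠ j → ∀ s ∈ C i, ∀ t ∈ C j, (s ∩ t).Nonempty)
    (hsize : ∀ i, ((C i).card : ℝ) ≤ p * ((∑ j, (C j).card : ℕ) : ℝ)) :
    (∑ j, (C j).card) ≤ (n - 1).choose (k - 1) := by
  classical
  obtain ⟨S, hS, hSc⟩ := exists_balanced_split (fun i ↦ (C i).card) hp hsize
  obtain ⟨D, hDinj, hDcard, hDinter⟩ := exists_injOn_finset_fin n
  have hunion (T : Finset (Fin r)) : (T.biUnion C).card = ∑ i ∈ T, (C i).card :=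
    Finset.card_biUnion fun i _ j _ hij ↦ hdisj i j hij
  have hground : ∀ T : Finset (Fin r), ∀ s ∈ T.biUnion C, s ⊆ Finset.Icc 1 n ∧ s.card = k := by
    intro T s hs
    obtain ⟨i, -, hi⟩ := Finset.mem_biUnion.1 hs
    exact hmem i s hi
  have hcard (T : Finset (Fin r)) : ((T.biUnion C).image D).card = ∑ i ∈ T, (C i).card := by
    rw [Finset.card_image_of_injOn (hDinj.mono fun s hs ↦ (hground T s hs).1), hunion]
  have huniform (T : Finset (Fin r)) : ∀ s ∈ (T.biUnion C).image D, s.card = k := by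
    intro u hu
    obtain ⟨s, hs, rfl⟩ := Finset.mem_image.1 hu
    rw [hDcard s (hground T s hs).1, (hground T s hs).2]
  have hne : ∀ i ∈ S, ∀ j ∈ Sᶜ, i ≠ j := fun i hi j hj hij ↦
    Finset.mem_compl.1 hj (hij ▸ hi)
  have hsum : ∑ i ∈ S, (C i).card + ∑ i ∈ Sᶜ, (C i).card = ∑ i, (C i).card :=
    Finset.sum_add_sum_compl S _
  have hmain := card_add_card_le_choose_of_cross_intersecting (p := p)
    (A := (S.biUnion C).image D) (B := (Sᶜ.biUnion C).image D) hk hp1 hn1 hn2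
    (huniform S) (huniform Sᶜ)
    (by
      rw [Finset.disjoint_left]
      intro u hu hu'
      obtain ⟨s, hs, rfl⟩ := Finset.mem_image.1 hu
      obtain ⟨t, ht, hts⟩ := Finset.mem_image.1 hu'
      obtain rfl : t = s := hDinj (hground _ t ht).1 (hground _ s hs).1 hts
      obtain ⟨i, hi, hsi⟩ := Finset.mem_biUnion.1 hs
      obtain ⟨j, hj, htj⟩ := Finset.mem_biUnion.1 ht
      exact Finset.disjoint_left.1 (hdisj i j (hne i hi j hj)) hsi htj)
    (by
      intro u hu v hv
      obtain ⟨s, hs, rfl⟩ := Finset.mem_image.1 hu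
      obtain ⟨t, ht, rfl⟩ := Finset.mem_image.1 hv
      obtain ⟨i, hi, hsi⟩ := Finset.mem_biUnion.1 hs
      obtain ⟨j, hj, htj⟩ := Finset.mem_biUnion.1 ht
      exact hDinter s (hground _ s hs).1 t (hcross i j (hne i hi j hj) s hsi t htj))
    (by rwa [hcard, hcard, hsum]) (by rwa [hcard, hcard, hsum])
  rwa [hcard, hcard, hsum] at hmain
end

section
/- Let p ∈ [2/3, 1) and let X be a p-separator of a finite graph G. Then the vertex set of G − X can be partitioned into two parts A and B with no edge of G between A and B, such that (1−p)·|V(G−X)| ≤ |A| ≤ (1/2)·|V(G−X)| and (1/2)·|V(G−X)| ≤ |B| ≤ p·|V(G−X)|. -/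
/-- `G.IsPSeparator p X` : `X` is a `p`-separator of `G`, i.e. no connected component of
the subgraph of `G` induced on the complement of `X` has more than `p·|V(G) \ X|` vertices. -/
def SimpleGraph.IsPSeparator {V : Type} [Fintype V] [DecidableEq V] (G : SimpleGraph V)
    (p : ℝ) (X : Finset V) : Prop :=
  ∀ c : (G.induce ((X : Set V)ᶜ)).ConnectedComponent,
    (Nat.card c.supp : ℝ) ≤ p * ((Fintype.card V - X.card : ℕ) : ℝ)

/-- A finite family of weights below `L` with total at least `L` has a subfamily with total
between `L` and `2 * L`. -/
theorem Finset.exists_subset_le_sum_le_two_mul {ι : Type*} {w : ι → ℝ} {L : ℝ} (hL : 0 ≤ L)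
    (hw : ∀ i, w i < L) (s : Finset ι) (hs : L ≤ ∑ i ∈ s, w i) :
    ∃ t ⊆ s, L ≤ ∑ i ∈ t, w i ∧ ∑ i ∈ t, w i ≤ 2 * L := by
  classical
  induction s using Finset.induction_on with
  | empty => exact ⟨∅, subset_rfl, hs, by simpa using hL⟩
  | insert a s ha ih =>
    by_cases h : L ≤ ∑ i ∈ s, w i
    · obtain ⟨t, hts, ht⟩ := ih h
      exact ⟨t, hts.trans (Finset.subset_insert a s), ht⟩
    · refine ⟨insert a s, subset_rfl, hs, ?_⟩
      rw [Finset.sum_insert ha]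
      linarith [hw a]

/-- Weights of total `n`, each at most `p * n` with `2 / 3 ≤ p`, have a subfamily with total
between `(1 - p) * n` and `p * n`. -/
theorem Finset.exists_sum_mem_Icc_of_le_mul {ι : Type*} [Fintype ι] {w : ι → ℝ} {p n : ℝ}
    (hp : 2 / 3 ≤ p) (hp1 : p < 1) (hn : 0 ≤ n) (hw : ∀ i, w i ≤ p * n)
    (hsum : ∑ i, w i = n) :
    ∃ t : Finset ι, (1 - p) * n ≤ ∑ i ∈ t, w i ∧ ∑ i ∈ t, w i ≤ p * n := by
  by_cases h : ∃ i, (1 - p) * n ≤ w i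
  · obtain ⟨i, hi⟩ := h
    exact ⟨{i}, by simpa using hi, by simpa using hw i⟩
  · push Not at h
    obtain ⟨t, -, h1, h2⟩ := Finset.exists_subset_le_sum_le_two_mul
      (mul_nonneg (by linarith) hn) h Finset.univ (by rw [hsum]; nlinarith)
    exact ⟨t, h1, h2.trans (by nlinarith)⟩

/-- The number of vertices lying in a finite set of connected components. -/
theorem SimpleGraph.card_filter_connectedComponentMk_mem {W : Type*} [Fintype W]
    (H : SimpleGraph W) [DecidableEq H.ConnectedComponent] (t : Finset H.ConnectedComponent) :
    (Finset.univ.filter fun v => H.connectedComponentMk v ∈ t).card =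
      ∑ c ∈ t, Nat.card c.supp := by
  classical
  rw [Finset.card_eq_sum_card_fiberwise (f := H.connectedComponentMk) (t := t)
    (by intro v hv; simpa using hv)]
  refine Finset.sum_congr rfl fun c hc => ?_
  rw [Nat.card_eq_card_toFinset]
  congr 1
  ext v
  simp only [Finset.mem_filter, Finset.mem_univ, true_and, Set.mem_toFinset,
    SimpleGraph.ConnectedComponent.mem_supp_iff]
  exact ⟨fun h => h.2, fun h => ⟨h ▸ hc, h⟩⟩

/-- If `X` is a `p`-separator of a finite graph `G` (for `p ∈ [2/3,1)`), then the vertices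
outside `X` can be partitioned into parts `A` and `B` with no edge between them, with
`(1-p)·|V(G-X)| ≤ |A| ≤ (1/2)·|V(G-X)|` and `(1/2)·|V(G-X)| ≤ |B| ≤ p·|V(G-X)|`. -/
theorem exists_partition_of_isPSeparator {V : Type} [Fintype V] [DecidableEq V]
    (G : SimpleGraph V) (p : ℝ) (hp : 2 / 3 ≤ p) (hp1 : p < 1) (X : Finset V)
    (hX : G.IsPSeparator p X) :
    ∃ A B : Finset V, A ∪ B = Xᶜ ∧ Disjoint A B ∧
      (∀ a ∈ A, ∀ b ∈ B, ¬ G.Adj a b) ∧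
      (1 - p) * (Xᶜ.card : ℝ) ≤ (A.card : ℝ) ∧ (A.card : ℝ) ≤ (1 / 2) * (Xᶜ.card : ℝ) ∧
      (1 / 2) * (Xᶜ.card : ℝ) ≤ (B.card : ℝ) ∧ (B.card : ℝ) ≤ p * (Xᶜ.card : ℝ) := by
  classical
  let H := G.induce ((X : Set V)ᶜ)
  have hn : (Fintype.card V - X.card : ℕ) = Xᶜ.card := (Finset.card_compl X).symm
  have hX' : ∀ c : H.ConnectedComponent, (Nat.card c.supp : ℝ) ≤ p * (Xᶜ.card : ℝ) := by
    intro c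
    rw [← hn]
    exact hX c
  let S (t : Finset H.ConnectedComponent) : Finset V :=
    (Finset.univ.filter fun v => H.connectedComponentMk v ∈ t).map (Function.Embedding.subtype _)
  have hScard (t) : ((S t).card : ℝ) = ∑ c ∈ t, (Nat.card c.supp : ℝ) := by
    rw [Finset.card_map, H.card_filter_connectedComponentMk_mem, Nat.cast_sum]
  have hmem (t) (v : V) :
      v ∈ S t ↔ ∃ h : v ∈ (X : Set V)ᶜ, H.connectedComponentMk ⟨v, h⟩ ∈ t := by
    simp [S]
  have hunion (t) : S t ∪ S tᶜ = Xᶜ := by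
    ext v
    simp only [Finset.mem_union, hmem, Finset.mem_compl, Set.mem_compl_iff, Finset.mem_coe]
    constructor
    · rintro (⟨h, -⟩ | ⟨h, -⟩) <;> exact h
    · intro h
      by_cases hc : H.connectedComponentMk ⟨v, h⟩ ∈ t
      exacts [Or.inl ⟨h, hc⟩, Or.inr ⟨h, hc⟩]
  have hdisj (t) : Disjoint (S t) (S tᶜ) := by
    rw [Finset.disjoint_left]
    intro v hv hv'
    obtain ⟨h, hc⟩ := (hmem t v).1 hv
    obtain ⟨h', hc'⟩ := (hmem tᶜ v).1 hv'
    exact Finset.mem_compl.1 hc' hc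
  have hadj (t) : ∀ a ∈ S t, ∀ b ∈ S tᶜ, ¬ G.Adj a b := by
    intro a ha b hb hab
    obtain ⟨h, hc⟩ := (hmem t a).1 ha
    obtain ⟨h', hc'⟩ := (hmem tᶜ b).1 hb
    have hH : H.Adj ⟨a, h⟩ ⟨b, h'⟩ := hab
    rw [SimpleGraph.ConnectedComponent.connectedComponentMk_eq_of_adj hH] at hc
    exact Finset.mem_compl.1 hc' hc
  have hcard (t) : ((S t).card : ℝ) + ((S tᶜ).card : ℝ) = (Xᶜ.card : ℝ) := by
    rw [← hunion t, Finset.card_union_of_disjoint (hdisj t), Nat.cast_add]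
  have hsum : ∑ c : H.ConnectedComponent, (Nat.card c.supp : ℝ) = (Xᶜ.card : ℝ) := by
    rw [← hcard Finset.univ, hScard, hScard, Finset.compl_univ, Finset.sum_empty, add_zero]
  obtain ⟨t, h1, h2⟩ :=
    Finset.exists_sum_mem_Icc_of_le_mul hp hp1 (Nat.cast_nonneg _) hX' hsum
  rw [← hScard] at h1 h2
  have h3 := hcard t
  rcases le_total ((S t).card : ℝ) ((1 / 2) * (Xᶜ.card : ℝ)) with h | h
  · exact ⟨S t, S tᶜ, hunion t, hdisj t, hadj t, h1, h, by linarith, by linarith⟩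
  · exact ⟨S tᶜ, S t, by rw [Finset.union_comm, hunion t], (hdisj t).symm,
      fun a ha b hb hab => hadj t b hb a ha hab.symm, by linarith, by linarith, h, h2⟩
end

section
/- Let k ≥ 2 and n ≥ 2k + 1 be integers. Let A and B be disjoint cross-intersecting families of k-element subsets of {1,...,n} with (1/3)·(|A| + |B|) ≤ |A| ≤ (1/2)·(|A| + |B|). Then |A| + |B| ≤ (3/√2)·C(n−1, k−1). -/
open Finset
open scoped FinsetFamily

/-- The colex order on `r`-sets has initial segments of every possible size. -/
lemma Finset.Colex.exists_isInitSeg_card_eq {α : Type*} [LinearOrder α] [Fintype α] (r m : ℕ)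
    (hm : m ≤ (Fintype.card α).choose r) :
    ∃ 𝒞 : Finset (Finset α), Colex.IsInitSeg 𝒞 r ∧ #𝒞 = m := by
  induction m with
  | zero => exact ⟨∅, Colex.isInitSeg_empty, rfl⟩
  | succ m ih =>
    obtain ⟨𝒞, h𝒞, rfl⟩ := ih (by lia)
    have hne : (powersetCard r univ \ 𝒞).Nonempty := by
      rw [← card_pos]
      have := le_card_sdiff 𝒞 (powersetCard r (univ : Finset α))
      rw [card_powersetCard, card_univ] at this
      lia
    obtain ⟨s, hs, hmin⟩ := exists_min_image _ (fun s : Finset α ↦ toColex s) hne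
    simp only [mem_sdiff, mem_powersetCard, subset_univ, true_and] at hs hmin
    refine ⟨insert s 𝒞, ⟨?_, ?_⟩, card_insert_of_notMem hs.2⟩
    · intro t ht
      rcases mem_insert.1 (mem_coe.1 ht) with rfl | ht
      exacts [hs.1, h𝒞.1 ht]
    · rintro t u ht ⟨hut, hu⟩
      rcases mem_insert.1 ht with rfl | ht
      · by_contra hu'
        exact (hmin u ⟨hu, fun h ↦ hu' (mem_insert_of_mem h)⟩).not_gt hut
      · exact mem_insert_of_mem (h𝒞.2 ht ⟨hut, hu⟩)

/-- The `r`-sets below a given element form an initial segment of colex. -/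
lemma Finset.Colex.isInitSeg_powersetCard_Iio {α : Type*} [LinearOrder α]
    [LocallyFiniteOrderBot α] (a : α) (r : ℕ) : Colex.IsInitSeg (powersetCard r (Iio a)) r := by
  refine ⟨Set.sized_powersetCard _ _, ?_⟩
  rintro s t hs ⟨hts, ht⟩
  rw [mem_powersetCard] at hs ⊢
  exact ⟨fun x hx ↦ mem_Iio.2 <|
    Colex.forall_lt_mono hts.le (fun b hb ↦ mem_Iio.1 (hs.1 hb)) x hx, ht⟩

lemma Finset.Colex.IsInitSeg.subset_of_card_le {α : Type*} [LinearOrder α]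
    {𝒜 ℬ : Finset (Finset α)} {r : ℕ} (h𝒜 : Colex.IsInitSeg 𝒜 r) (hℬ : Colex.IsInitSeg ℬ r)
    (h : #𝒜 ≤ #ℬ) : 𝒜 ⊆ ℬ := by
  obtain h' | h' := h𝒜.total hℬ
  · exact h'
  · exact (eq_of_subset_of_card_le h' h).ge

/-- Normalized matching between complementary levels of the subsets of `W`. -/
lemma Finset.card_le_card_filter_exists_subset {α : Type*} [DecidableEq α] {W : Finset α}
    {𝒮 : Finset (Finset α)} {q j : ℕ} (hqj : q + j = #W) (hjq : j ≤ q)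
    (h𝒮 : 𝒮 ⊆ powersetCard q W) :
    #𝒮 ≤ #{t ∈ powersetCard j W | ∃ u ∈ 𝒮, t ⊆ u} := by
  refine Nat.le_of_mul_le_mul_right ?_ (Nat.choose_pos hjq)
  refine card_mul_le_card_mul (fun u t ↦ t ⊆ u) (fun u hu ↦ ?_) (fun t ht ↦ ?_)
  · obtain ⟨huW, rfl⟩ := mem_powersetCard.1 (h𝒮 hu)
    rw [← card_powersetCard]
    refine card_le_card fun t ht ↦ ?_
    rw [mem_powersetCard] at ht
    simp only [bipartiteAbove, mem_filter, mem_powersetCard]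
    exact ⟨⟨⟨ht.1.trans huW, ht.2⟩, u, hu, ht.1⟩, ht.1⟩
  · obtain ⟨htW, htj⟩ := mem_powersetCard.1 (mem_filter.1 ht).1
    have hc : #(powersetCard j (W \ t)) = q.choose j := by
      rw [card_powersetCard, card_sdiff_of_subset htW, htj, ← hqj, Nat.add_sub_cancel]
    rw [← hc]
    have hW : ∀ u ∈ bipartiteBelow (fun u t ↦ t ⊆ u) 𝒮 t, u ⊆ W ∧ #u = q ∧ t ⊆ u := by
      intro u hu
      rw [bipartiteBelow, mem_filter] at hu
      have := mem_powersetCard.1 (h𝒮 hu.1)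
      exact ⟨this.1, this.2, hu.2⟩
    refine card_le_card_of_injOn (W \ ·) (fun u hu ↦ ?_) (fun u hu v hv huv ↦ ?_)
    · obtain ⟨h1, h2, h3⟩ := hW u hu
      rw [mem_coe, mem_powersetCard, card_sdiff_of_subset h1]
      exact ⟨sdiff_subset_sdiff Subset.rfl h3, by lia⟩
    · rw [← sdiff_sdiff_eq_self (hW u hu).1, ← sdiff_sdiff_eq_self (hW v hv).1]
      exact congrArg (W \ ·) huv

/-- Iterated shadow bound for an initial segment of colex lying between all `(q + 1)`-subsets
of the first `q + j` points and all those of the first `q + j + 1` points. -/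
lemma Finset.Colex.IsInitSeg.card_add_le_card_shadow_iterate {q j : ℕ} (hj : 1 ≤ j) (hjq : j ≤ q)
    {𝒞 : Finset (Finset (Fin (q + j + 2)))} (h𝒞 : Colex.IsInitSeg 𝒞 (q + 1))
    (hl : (q + j).choose (q + 1) ≤ #𝒞) (hu : #𝒞 ≤ (q + j + 1).choose (q + 1)) :
    #𝒞 + (q + j).choose (j + 1) ≤ #(∂^[q - j] 𝒞) + (q + j).choose (q + 1) := by
  let p : Fin (q + j + 2) := ⟨q + j, by lia⟩
  let W := Iio p
  have hW : #W = q + j := by simp [W, p]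
  have hpW : p ∉ W := by simp [W]
  have hlast : Iio (Fin.last (q + j + 1)) = insert p W := by
    ext x
    simp only [W, p, mem_Iio, mem_insert, Fin.lt_def, Fin.ext_iff, Fin.val_last]
    lia
  have hP : powersetCard (q + 1) W ⊆ 𝒞 :=
    (Colex.isInitSeg_powersetCard_Iio p _).subset_of_card_le h𝒞 (by
      rwa [card_powersetCard, hW])
  have hQ : 𝒞 ⊆ powersetCard (q + 1) (insert p W) := by
    rw [← hlast]
    refine h𝒞.subset_of_card_le (Colex.isInitSeg_powersetCard_Iio _ _) ?_
    rw [card_powersetCard, hlast, card_insert_of_notMem hpW, hW]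
    exact hu
  let D := 𝒞 \ powersetCard (q + 1) W
  have hD : ∀ s ∈ D, s ∈ 𝒞 ∧ s ⊆ insert p W ∧ #s = q + 1 ∧ p ∈ s := by
    intro s hs
    obtain ⟨hs1, hs2⟩ := mem_sdiff.1 hs
    obtain ⟨hs3, hs4⟩ := mem_powersetCard.1 (hQ hs1)
    refine ⟨hs1, hs3, hs4, ?_⟩
    by_contra hp
    exact hs2 (mem_powersetCard.2 ⟨(subset_insert_iff_of_notMem hp).1 hs3, hs4⟩)
  let R := D.image (·.erase p)
  have hR : R ⊆ powersetCard q W := by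
    intro u hu
    obtain ⟨s, hs, rfl⟩ := mem_image.1 hu
    obtain ⟨-, h1, h2, h3⟩ := hD s hs
    rw [mem_powersetCard, card_erase_of_mem h3, h2]
    exact ⟨subset_insert_iff.1 h1, rfl⟩
  have hRcard : #R = #𝒞 - (q + j).choose (q + 1) := by
    rw [card_image_of_injOn, card_sdiff_of_subset hP, card_powersetCard, hW]
    intro s hs t ht hst
    rw [← insert_erase (hD s hs).2.2.2, ← insert_erase (hD t ht).2.2.2]
    exact congrArg (insert p) hst
  let T := {t ∈ powersetCard j W | ∃ u ∈ R, t ⊆ u}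
  have hRT : #R ≤ #T := card_le_card_filter_exists_subset hW.symm hjq hR
  have hT : ∀ t ∈ T, t ⊆ W ∧ #t = j ∧ ∃ u ∈ R, t ⊆ u := by
    intro t ht
    obtain ⟨h1, h2⟩ := mem_filter.1 ht
    exact ⟨(mem_powersetCard.1 h1).1, (mem_powersetCard.1 h1).2, h2⟩
  have hTcard : #(T.image (insert p)) = #T := by
    refine card_image_of_injOn fun s hs t ht hst ↦ ?_
    rw [← erase_insert (fun h ↦ hpW ((hT s hs).1 h)), ← erase_insert (fun h ↦ hpW ((hT t ht).1 h))]
    exact congrArg (·.erase p) hst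
  have hdisj : Disjoint (powersetCard (j + 1) W) (T.image (insert p)) := by
    rw [disjoint_left]
    rintro s hs hs'
    obtain ⟨t, -, rfl⟩ := mem_image.1 hs'
    exact hpW ((mem_powersetCard.1 hs).1 (mem_insert_self _ _))
  have hsub : powersetCard (j + 1) W ∪ T.image (insert p) ⊆ ∂^[q - j] 𝒞 := by
    intro s hs
    rw [mem_shadow_iterate_iff_exists_mem_card_add]
    rcases mem_union.1 hs with hs | hs
    · obtain ⟨h1, h2⟩ := mem_powersetCard.1 hs
      obtain ⟨u, hsu, huW, hu⟩ := exists_subsuperset_card_eq (n := q + 1) h1 (by lia) (by lia)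
      exact ⟨u, hP (mem_powersetCard.2 ⟨huW, hu⟩), hsu, by lia⟩
    · obtain ⟨t, ht, rfl⟩ := mem_image.1 hs
      obtain ⟨h1, h2, u, hu, htu⟩ := hT t ht
      obtain ⟨v, hv, rfl⟩ := mem_image.1 hu
      obtain ⟨h3, -, h4, h5⟩ := hD v hv
      refine ⟨v, h3, insert_subset h5 (htu.trans (erase_subset _ _)), ?_⟩
      rw [card_insert_of_notMem fun h ↦ hpW (h1 h)]
      lia
  have := card_le_card hsub
  rw [card_union_of_disjoint hdisj, hTcard, card_powersetCard, hW] at this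
  lia

/-- If two cross-intersecting families of `(j + 1)`-sets in `q + j + 2` points satisfy
`C(q + j, j - 1) ≤ |𝒜| ≤ C(q + j + 1, j)`, then `|𝒜| + |ℬ| ≤ 2 C(q + j + 1, j)`. -/
lemma card_add_card_le_of_cross_intersecting_fin {q j : ℕ} (hj : 1 ≤ j) (hjq : j ≤ q)
    {𝒜 ℬ : Finset (Finset (Fin (q + j + 2)))}
    (h𝒜 : (𝒜 : Set (Finset (Fin (q + j + 2)))).Sized (j + 1))
    (hℬ : (ℬ : Set (Finset (Fin (q + j + 2)))).Sized (j + 1))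
    (hcross : ∀ s ∈ 𝒜, ∀ t ∈ ℬ, ¬ Disjoint s t)
    (hl : (q + j).choose (j - 1) ≤ #𝒜) (hu : #𝒜 ≤ (q + j + 1).choose j) :
    #𝒜 + #ℬ ≤ 2 * (q + j + 1).choose j := by
  have e1 : (q + j).choose (q + 1) = (q + j).choose (j - 1) :=
    Nat.choose_symm_of_eq_add (by lia)
  have e2 : (q + j + 1).choose (q + 1) = (q + j + 1).choose j :=
    Nat.choose_symm_of_eq_add (by lia)
  have e3 : (q + j + 2).choose (j + 1) = (q + j + 1).choose j + (q + j + 1).choose (j + 1) :=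
    Nat.choose_succ_succ _ _
  have e4 : (q + j + 1).choose (j + 1) = (q + j).choose j + (q + j).choose (j + 1) :=
    Nat.choose_succ_succ _ _
  have e5 : (q + j + 1).choose j = (q + j).choose (j - 1) + (q + j).choose j := by
    obtain ⟨i, rfl⟩ := Nat.exists_eq_add_of_le' hj
    exact Nat.choose_succ_succ _ _
  have hcompl : (𝒜ᶜˢ : Set (Finset (Fin (q + j + 2)))).Sized (q + 1) := by
    have := h𝒜.compls
    rwa [Fintype.card_fin, show q + j + 2 - (j + 1) = q + 1 by lia] at this
  obtain ⟨𝒞, h𝒞, h𝒞card⟩ := Colex.exists_isInitSeg_card_eq (α := Fin (q + j + 2)) (q + 1) #𝒜 (by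
    rw [← card_compls]
    exact hcompl.card_le)
  have hkk : #(∂^[q - j] 𝒞) ≤ #(∂^[q - j] 𝒜ᶜˢ) :=
    iterated_kk hcompl (by rw [card_compls, h𝒞card]) h𝒞
  have hshadow := h𝒞.card_add_le_card_shadow_iterate hj hjq (by lia) (by lia)
  have hdisj : Disjoint ℬ (∂^[q - j] 𝒜ᶜˢ) := by
    rw [disjoint_right]
    intro t ht htℬ
    obtain ⟨s, hs, hts, -⟩ := mem_shadow_iterate_iff_exists_sdiff.1 ht
    exact hcross _ (mem_compls.1 hs) t htℬ (disjoint_compl_left.mono_right hts)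
  have htotal : #(ℬ ∪ ∂^[q - j] 𝒜ᶜˢ) ≤ (q + j + 2).choose (j + 1) := by
    have : ((ℬ ∪ ∂^[q - j] 𝒜ᶜˢ : Finset _) : Set (Finset (Fin (q + j + 2)))).Sized (j + 1) := by
      rw [coe_union, Set.sized_union]
      refine ⟨hℬ, ?_⟩
      have := hcompl.shadow_iterate (k := q - j)
      rwa [show q + 1 - (q - j) = j + 1 by lia] at this
    simpa using this.card_le
  rw [card_union_of_disjoint hdisj] at htotal
  lia

/-- The total size of two cross-intersecting families of `(j + 1)`-sets in `q + j + 2` points,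
neither more than twice as large as the other, is at most `2 C(q + j + 1, j)`. -/
lemma card_add_card_le_of_cross_intersecting_of_le_two_mul {q j : ℕ} (hj : 1 ≤ j) (hjq : j ≤ q)
    {𝒜 ℬ : Finset (Finset (Fin (q + j + 2)))}
    (h𝒜 : (𝒜 : Set (Finset (Fin (q + j + 2)))).Sized (j + 1))
    (hℬ : (ℬ : Set (Finset (Fin (q + j + 2)))).Sized (j + 1))
    (hcross : ∀ s ∈ 𝒜, ∀ t ∈ ℬ, ¬ Disjoint s t)
    (hle : #𝒜 ≤ #ℬ) (hle' : #ℬ ≤ 2 * #𝒜) :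
    #𝒜 + #ℬ ≤ 2 * (q + j + 1).choose j := by
  by_cases hb : #ℬ ≤ (q + j + 1).choose j
  · lia
  have h1 : (q + j + 1).choose j = (q + j).choose (j - 1) + (q + j).choose j := by
    obtain ⟨i, rfl⟩ := Nat.exists_eq_add_of_le' hj
    exact Nat.choose_succ_succ _ _
  have h2 : (q + j).choose (j - 1) ≤ (q + j).choose j := by
    have := Nat.choose_le_succ_of_lt_half_left (r := j - 1) (n := q + j) (by lia)
    rwa [Nat.sub_add_cancel hj] at this
  obtain ⟨𝒜', hsub, hcard⟩ := exists_subset_card_eq (min_le_left #𝒜 ((q + j + 1).choose j))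
  have := card_add_card_le_of_cross_intersecting_fin hj hjq (h𝒜.mono (coe_subset.2 hsub)) hℬ
    (fun s hs ↦ hcross s (hsub hs)) (by lia) (by lia)
  lia

/-- A family of subsets of `{1, ..., n}` is the image of a family of subsets of `Fin n`. -/
lemma exists_eq_image_map_of_subset_Icc {n : ℕ} {A : Finset (Finset ℕ)}
    (hA : ∀ s ∈ A, s ⊆ Icc 1 n) :
    ∃ 𝒜 : Finset (Finset (Fin n)),
      A = 𝒜.map (mapEmbedding (Fin.valEmbedding.trans (addRightEmbedding 1))).toEmbedding := by
  suffices A ⊆ univ.map (mapEmbedding (Fin.valEmbedding.trans (addRightEmbedding 1))).toEmbedding by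
    obtain ⟨𝒜, -, h⟩ := subset_map_iff.1 this
    exact ⟨𝒜, h⟩
  intro s hs
  have hs' : s ⊆ univ.map ((Fin.valEmbedding (n := n)).trans (addRightEmbedding 1)) := by
    intro x hx
    have := mem_Icc.1 (hA s hs hx)
    exact mem_map.2 ⟨⟨x - 1, by lia⟩, mem_univ _, Nat.sub_add_cancel this.1⟩
  obtain ⟨t, -, rfl⟩ := subset_map_iff.1 hs'
  exact mem_map_of_mem _ (mem_univ t)

/-- Let `k ≥ 2` and `n ≥ 2k + 1`, and let `A` and `B` be disjoint cross-intersecting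
families of `k`-element subsets of `{1,...,n}` with
`(1/3)(|A|+|B|) ≤ |A| ≤ (1/2)(|A|+|B|)`. Then `|A| + |B| ≤ (3/√2)·C(n-1,k-1)`. -/
theorem cross_intersecting_card_le (n k : ℕ) (hk : 2 ≤ k) (hn : 2 * k + 1 ≤ n)
    (A B : Finset (Finset ℕ))
    (hA : ∀ s ∈ A, s ⊆ Finset.Icc 1 n ∧ s.card = k)
    (hB : ∀ t ∈ B, t ⊆ Finset.Icc 1 n ∧ t.card = k)
    (hdisj : Disjoint A B)
    (hcross : ∀ s ∈ A, ∀ t ∈ B, (s ∩ t).Nonempty)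
    (h1 : (1 / 3 : ℝ) * ((A.card + B.card : ℕ) : ℝ) ≤ (A.card : ℝ))
    (h2 : (A.card : ℝ) ≤ (1 / 2 : ℝ) * ((A.card + B.card : ℕ) : ℝ)) :
    ((A.card + B.card : ℕ) : ℝ) ≤ 3 / Real.sqrt 2 * ((n - 1).choose (k - 1) : ℝ) := by
  obtain ⟨j, rfl⟩ : ∃ j, k = j + 1 := ⟨k - 1, by lia⟩
  obtain ⟨q, rfl⟩ : ∃ q, n = q + j + 2 := ⟨n - j - 2, by lia⟩
  obtain ⟨𝒜, rfl⟩ := exists_eq_image_map_of_subset_Icc fun s hs ↦ (hA s hs).1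
  obtain ⟨ℬ, rfl⟩ := exists_eq_image_map_of_subset_Icc fun s hs ↦ (hB s hs).1
  simp only [card_map] at h1 h2 ⊢
  have h𝒜 : (𝒜 : Set (Finset (Fin (q + j + 2)))).Sized (j + 1) := fun s hs ↦ by
    simpa using (hA _ (mem_map_of_mem _ hs)).2
  have hℬ : (ℬ : Set (Finset (Fin (q + j + 2)))).Sized (j + 1) := fun s hs ↦ by
    simpa using (hB _ (mem_map_of_mem _ hs)).2
  have hle : #𝒜 ≤ #ℬ := by
    have : (#𝒜 : ℝ) ≤ #ℬ := by push_cast at h2; linarith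
    exact_mod_cast this
  have hle' : #ℬ ≤ 2 * #𝒜 := by
    have : (#ℬ : ℝ) ≤ 2 * #𝒜 := by push_cast at h1; linarith
    exact_mod_cast this
  have key := card_add_card_le_of_cross_intersecting_of_le_two_mul (by lia) (by lia) h𝒜 hℬ
    (fun s hs t ht hst ↦ (hcross _ (mem_map_of_mem _ hs) _ (mem_map_of_mem _ ht)).ne_empty <|
      disjoint_iff_inter_eq_empty.1 <| (disjoint_map _).2 hst) hle hle'
  have hsqrt : (2 : ℝ) ≤ 3 / √2 := by
    rw [le_div_iff₀ (by positivity)]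
    nlinarith [Real.sq_sqrt (show (0 : ℝ) ≤ 2 by norm_num), Real.sqrt_nonneg 2]
  calc ((#𝒜 + #ℬ : ℕ) : ℝ) ≤ 2 * ((q + j + 1).choose j : ℝ) := by exact_mod_cast key
    _ ≤ 3 / √2 * ((q + j + 1).choose j : ℝ) := by gcongr
end

section
/- Let k ≥ 2 be an integer, let p ∈ [2/3, 1), and let n ≥ max(4k² − 4k + 3, (k² − 1)/(1 − p) + 2). Let A and B be disjoint cross-intersecting families of k-element subsets of {1,...,n} with (1−p)·(|A| + |B|) ≤ |A| ≤ (1/2)·(|A| + |B|) ≤ |B| ≤ p·(|A| + |B|). Then |A| + |B| ≤ C(n−1, k−1). -/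
open Finset

/-- A family of `k`-subsets of `V` that all contain `P` has at most
`C(|V| - |P|, k - |P|)` members. -/
theorem card_le_choose_of_forall_superset {α : Type*} [DecidableEq α] {V P : Finset α} {k : ℕ}
    {F : Finset (Finset α)} (hF : ∀ s ∈ F, s ⊆ V ∧ s.card = k) (hP : ∀ s ∈ F, P ⊆ s) :
    F.card ≤ (V.card - P.card).choose (k - P.card) := by
  rcases F.eq_empty_or_nonempty with rfl | ⟨s₀, hs₀⟩
  · simp
  have hPV : P ⊆ V := (hP s₀ hs₀).trans (hF s₀ hs₀).1
  rw [← card_sdiff_of_subset hPV, ← card_powersetCard]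
  refine card_le_card_of_injOn (fun s => s \ P) ?_ ?_
  · intro s hs
    have hs' : s ∈ F := by simpa using hs
    simp only [mem_coe, mem_powersetCard]
    refine ⟨sdiff_subset_sdiff (hF s hs').1 le_rfl, ?_⟩
    rw [card_sdiff_of_subset (hP s hs'), (hF s hs').2]
  · intro s hs u hu hsu
    have hs' : s ∈ F := by simpa using hs
    have hu' : u ∈ F := by simpa using hu
    rw [← sdiff_union_of_subset (hP s hs'), ← sdiff_union_of_subset (hP u hu')]
    exact congrArg (· ∪ P) hsu

/-- If every member of `F` meets `D`, then `F` is bounded by the sum of the sizes of the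
subfamilies of the sets that contain a given element of `D`. -/
theorem card_le_card_mul_of_forall_inter_nonempty {α : Type*} [DecidableEq α]
    {F : Finset (Finset α)} {D : Finset α} {m : ℕ} (hD : ∀ s ∈ F, (s ∩ D).Nonempty)
    (hm : ∀ j ∈ D, (F.filter (j ∈ ·)).card ≤ m) : F.card ≤ D.card * m := by
  have hsub : F ⊆ D.biUnion fun j => F.filter (j ∈ ·) := by
    intro s hs
    obtain ⟨j, hj⟩ := hD s hs
    rw [mem_inter] at hj
    exact mem_biUnion.2 ⟨j, hj.2, mem_filter.2 ⟨hs, hj.1⟩⟩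
  exact (card_le_card hsub).trans (card_biUnion_le_card_mul _ _ _ hm)

/-- Branching bound: if all members of `F` contain `P`, and no `Q ⊇ P` with fewer than
`|P| + r` elements meets every member of the cross-intersecting family `B`, then
`|F| ≤ k ^ r * C(n - |P| - r, k - |P| - r)`. -/
theorem card_le_pow_mul_choose {α : Type*} [DecidableEq α] {V : Finset α} {k : ℕ}
    {B : Finset (Finset α)} (hB : ∀ t ∈ B, t.card = k) (r : ℕ) :
    ∀ (P : Finset α) (F : Finset (Finset α)), (∀ s ∈ F, s ⊆ V ∧ s.card = k) →
      (∀ s ∈ F, P ⊆ s) → (∀ s ∈ F, ∀ t ∈ B, (s ∩ t).Nonempty) →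
      (∀ Q, P ⊆ Q → Q.card < P.card + r → ∃ t ∈ B, Disjoint Q t) →
      F.card ≤ k ^ r * (V.card - (P.card + r)).choose (k - (P.card + r)) := by
  induction r with
  | zero =>
    intro P F hF hP _ _
    simpa using card_le_choose_of_forall_superset hF hP
  | succ r ih =>
    intro P F hF hP hcross hQ
    obtain ⟨t, ht, hPt⟩ := hQ P le_rfl (by omega)
    rw [pow_succ', mul_assoc, ← hB t ht]
    refine card_le_card_mul_of_forall_inter_nonempty (fun s hs => hcross s hs t ht) ?_
    intro j hj
    have hjP : j ∉ P := fun h => disjoint_left.1 hPt h hj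
    have hcard : (insert j P).card + r = P.card + (r + 1) := by
      rw [card_insert_of_notMem hjP]; omega
    rw [← hcard, hB t ht]
    refine ih (insert j P) _ (fun s hs => hF s (mem_filter.1 hs).1) ?_
      (fun s hs => hcross s (mem_filter.1 hs).1) ?_
    · intro s hs
      exact insert_subset (mem_filter.1 hs).2 (hP s (mem_filter.1 hs).1)
    · intro Q hPQ hQc
      exact hQ Q ((subset_insert _ _).trans hPQ) (hcard ▸ hQc)

/-- If `D` meets every member of `A`, and no set with fewer than `t` elements meets every
member of the cross-intersecting family `B`, then `|A| ≤ |D| * k ^ (t-1) * C(n-t, k-t)`. -/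
theorem card_le_cover_mul_pow_mul_choose {α : Type*} [DecidableEq α] {V D : Finset α}
    {k r : ℕ} {A B : Finset (Finset α)} (hA : ∀ s ∈ A, s ⊆ V ∧ s.card = k)
    (hB : ∀ t ∈ B, t.card = k) (hcross : ∀ s ∈ A, ∀ t ∈ B, (s ∩ t).Nonempty)
    (hD : ∀ s ∈ A, (s ∩ D).Nonempty)
    (hQ : ∀ Q : Finset α, Q.card < r + 1 → ∃ t ∈ B, Disjoint Q t) :
    A.card ≤ D.card * (k ^ r * (V.card - (r + 1)).choose (k - (r + 1))) := by
  refine card_le_card_mul_of_forall_inter_nonempty hD fun j _ => ?_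
  have h := card_le_pow_mul_choose (V := V) hB r {j} (A.filter (j ∈ ·))
    (fun s hs => hA s (mem_filter.1 hs).1)
    (fun s hs => singleton_subset_iff.2 (mem_filter.1 hs).2)
    (fun s hs => hcross s (mem_filter.1 hs).1)
    (fun Q _ hc => hQ Q (by rw [card_singleton] at hc; omega))
  simpa [add_comm 1 r] using h

/-- A family all of whose members contain `i`, cross-intersecting with a `k`-set avoiding
`i`, has at most `k * C(n-2, k-2)` members. -/
theorem card_le_of_forall_mem_of_notMem {α : Type*} [DecidableEq α] {V : Finset α}
    {k : ℕ} {A B : Finset (Finset α)} (hA : ∀ s ∈ A, s ⊆ V ∧ s.card = k)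
    (hB : ∀ t ∈ B, t.card = k) (hcross : ∀ s ∈ A, ∀ t ∈ B, (s ∩ t).Nonempty)
    {i : α} (hi : ∀ s ∈ A, i ∈ s) {t : Finset α} (ht : t ∈ B) (hit : i ∉ t) :
    A.card ≤ k * (V.card - 2).choose (k - 2) := by
  have h := card_le_pow_mul_choose (V := V) hB 1 {i} A hA
    (fun s hs => singleton_subset_iff.2 (hi s hs)) hcross
    (fun Q hQ hc => ⟨t, ht, by
      rw [← eq_of_subset_of_card_le hQ (by omega)]
      exact disjoint_singleton_left.2 hit⟩)
  simpa using h

/-- The least size of a set meeting every member of a nonempty family without a common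
element, together with its minimality. -/
theorem exists_minimal_cover {α : Type*} [DecidableEq α] {A : Finset (Finset α)}
    (hne : A.Nonempty) (hcommon : ∀ i, ∃ s ∈ A, i ∉ s) {S : Finset α}
    (hS : ∀ s ∈ A, (s ∩ S).Nonempty) :
    ∃ D : Finset α, 2 ≤ D.card ∧ D.card ≤ S.card ∧ (∀ s ∈ A, (s ∩ D).Nonempty) ∧
      ∀ Q : Finset α, Q.card < D.card → ∃ s ∈ A, Disjoint Q s := by
  classical
  have hex : ∃ r, ∃ D : Finset α, D.card = r ∧ ∀ s ∈ A, (s ∩ D).Nonempty := ⟨_, S, rfl, hS⟩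
  obtain ⟨D, hDc, hD⟩ := Nat.find_spec hex
  refine ⟨D, ?_, hDc ▸ Nat.find_min' hex ⟨S, rfl, hS⟩, hD, ?_⟩
  · by_contra! hlt
    rcases Nat.lt_succ_iff.1 hlt |>.eq_or_lt with h | h
    · obtain ⟨i, rfl⟩ := card_eq_one.1 h
      obtain ⟨s, hs, his⟩ := hcommon i
      have := hD s hs
      rw [inter_singleton_of_notMem his] at this
      exact not_nonempty_empty this
    · obtain ⟨s, hs⟩ := hne
      have := hD s hs
      rw [card_eq_zero.1 (Nat.lt_one_iff.1 h), inter_empty] at this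
      exact not_nonempty_empty this
  · intro Q hQ
    by_contra! hcon
    refine Nat.find_min hex (hDc ▸ hQ) ⟨Q, rfl, fun s hs => ?_⟩
    rw [inter_comm]
    exact not_disjoint_iff_nonempty_inter.1 (hcon s hs)

theorem pow_mul_choose_sub_le {n k c : ℕ} (hc : c * k ≤ n) (hkn : k ≤ n) {j : ℕ} (hj : j ≤ k) :
    c ^ j * (n - j).choose (k - j) ≤ n.choose k := by
  induction j with
  | zero => simp
  | succ j ih =>
    refine le_trans ?_ (ih (by omega))
    rw [pow_succ, mul_assoc]
    refine Nat.mul_le_mul_left _ ?_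
    obtain ⟨a, rfl⟩ : ∃ a, k = j + 1 + a := ⟨k - (j + 1), by omega⟩
    obtain ⟨b, rfl⟩ : ∃ b, n = j + 1 + b := ⟨n - (j + 1), by omega⟩
    have e1 : j + 1 + b - (j + 1) = b := by omega
    have e2 : j + 1 + a - (j + 1) = a := by omega
    have e3 : j + 1 + b - j = b + 1 := by omega
    have e4 : j + 1 + a - j = a + 1 := by omega
    rw [e1, e2, e3, e4]
    have hab : c * (a + 1) ≤ b + 1 := by
      rcases Nat.eq_zero_or_pos c with rfl | hcpos
      · simp
      · nlinarith
    refine Nat.le_of_mul_le_mul_right ?_ (Nat.succ_pos a)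
    calc c * b.choose a * (a + 1) = c * (a + 1) * b.choose a := by ring
      _ ≤ (b + 1) * b.choose a := Nat.mul_le_mul_right _ hab
      _ = (b + 1).choose (a + 1) * (a + 1) := Nat.add_one_mul_choose_eq b a

/-- The bound of `card_le_cover_mul_pow_mul_choose` in terms of `C(n-2, k-2)`. -/
theorem four_pow_mul_card_le {α : Type*} [DecidableEq α] {V D : Finset α}
    {n k r : ℕ} {A B : Finset (Finset α)} (hV : V.card = n + 2) (hn : 4 * (k + 2) * k ≤ n)
    (hr : r ≤ k) (hA : ∀ s ∈ A, s ⊆ V ∧ s.card = k + 2)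
    (hB : ∀ t ∈ B, t.card = k + 2) (hcross : ∀ s ∈ A, ∀ t ∈ B, (s ∩ t).Nonempty)
    (hD : ∀ s ∈ A, (s ∩ D).Nonempty)
    (hQ : ∀ Q : Finset α, Q.card < r + 2 → ∃ t ∈ B, Disjoint Q t) :
    4 ^ r * A.card ≤ D.card * ((k + 2) * n.choose k) := by
  have h := card_le_cover_mul_pow_mul_choose (r := r + 1) hA hB hcross hD hQ
  have e1 : V.card - (r + 1 + 1) = n - r := by omega
  have e2 : k + 2 - (r + 1 + 1) = k - r := by omega
  rw [e1, e2] at h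
  have h' := pow_mul_choose_sub_le hn (by nlinarith) hr
  calc 4 ^ r * A.card ≤ 4 ^ r * (D.card * ((k + 2) ^ (r + 1) * (n - r).choose (k - r))) :=
        Nat.mul_le_mul_left _ h
    _ = D.card * ((k + 2) * ((4 * (k + 2)) ^ r * (n - r).choose (k - r))) := by
        rw [mul_pow, pow_succ]; ring
    _ ≤ _ := by gcongr

theorem four_mul_add_two_le_three_mul_four_pow (r : ℕ) (hr : 1 ≤ r) :
    4 * (r + 2) ≤ 3 * 4 ^ r := by
  induction r, hr using Nat.le_induction with
  | base => norm_num
  | succ r hr ih => rw [pow_succ]; omega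

theorem add_two_le_two_mul_four_pow (r : ℕ) : r + 2 ≤ 2 * 4 ^ r := by
  have := Nat.lt_pow_self (n := r) (a := 4) (by norm_num)
  have := Nat.one_le_pow r 4 (by norm_num)
  omega

/-- The numerical contradiction between the branching bounds for two cross-intersecting
families with covering numbers `u + 2` and `v + 2`. -/
theorem add_le_of_four_pow_mul_le {a b k N u v : ℕ} (hN : 0 < N) (ha : (k + 1) * N ≤ a)
    (hb : 2 * k * N ≤ b) (hk : 0 < k) (h1 : 4 ^ v * a ≤ (u + 2) * (k * N))
    (h2 : 4 ^ u * b ≤ (v + 2) * (k * N)) : a + b ≤ 4 * k * N := by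
  rcases Nat.eq_zero_or_pos (u + v) with h0 | hpos
  · obtain ⟨rfl, rfl⟩ : u = 0 ∧ v = 0 := by omega
    simp only [pow_zero, one_mul, zero_add] at h1 h2
    nlinarith
  exfalso
  have hprod : 2 * ((u + 2) * (v + 2)) ≤ 3 * (4 ^ u * 4 ^ v) := by
    rcases Nat.eq_zero_or_pos u with hu | hu
    · have hv := four_mul_add_two_le_three_mul_four_pow v (by omega)
      have := Nat.mul_le_mul (add_two_le_two_mul_four_pow u) hv
      nlinarith
    · have hu' := four_mul_add_two_le_three_mul_four_pow u hu
      have := Nat.mul_le_mul hu' (add_two_le_two_mul_four_pow v)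
      nlinarith
  have hM : 0 < k * N := Nat.mul_pos hk hN
  have hab : 2 * (k * N) * (k * N) ≤ a * b := by
    have : (k * N) * (2 * k * N) ≤ a * b := Nat.mul_le_mul (by nlinarith) hb
    nlinarith
  have h12 := Nat.mul_le_mul h1 h2
  have hP : 0 < 4 ^ u * 4 ^ v := by positivity
  generalize k * N = M at *
  generalize hPe : 4 ^ u * 4 ^ v = P at *
  have e : 4 ^ v * a * (4 ^ u * b) = P * (a * b) := by rw [← hPe]; ring
  rw [e] at h12
  have l1 : P * (2 * M * M) ≤ P * (a * b) := Nat.mul_le_mul_left _ hab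
  have l2 : 2 * ((u + 2) * (v + 2)) * (M * M) ≤ 3 * P * (M * M) := Nat.mul_le_mul_right _ hprod
  have l3 : 0 < P * (M * M) := by positivity
  nlinarith

/-- Let `k ≥ 2`, `p ∈ [2/3,1)` and `n ≥ max(4k² - 4k + 3, (k² - 1)/(1-p) + 2)`. If `A`
and `B` are disjoint cross-intersecting families of `k`-element subsets of `{1,...,n}`
with `(1-p)(|A|+|B|) ≤ |A| ≤ (1/2)(|A|+|B|) ≤ |B| ≤ p(|A|+|B|)`, then
`|A| + |B| ≤ C(n-1,k-1)`. -/
theorem disjoint_cross_intersecting_card_le (n k : ℕ) (p : ℝ) (hk : 2 ≤ k)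
    (hp : 2 / 3 ≤ p) (hp1 : p < 1)
    (hn1 : 4 * k ^ 2 - 4 * k + 3 ≤ n) (hn2 : ((k : ℝ) ^ 2 - 1) / (1 - p) + 2 ≤ (n : ℝ))
    (A B : Finset (Finset ℕ))
    (hA : ∀ s ∈ A, s ⊆ Finset.Icc 1 n ∧ s.card = k)
    (hB : ∀ t ∈ B, t ⊆ Finset.Icc 1 n ∧ t.card = k)
    (hdisj : Disjoint A B)
    (hcross : ∀ s ∈ A, ∀ t ∈ B, (s ∩ t).Nonempty)
    (h1 : (1 - p) * ((A.card + B.card : ℕ) : ℝ) ≤ (A.card : ℝ))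
    (h2 : (A.card : ℝ) ≤ (1 / 2 : ℝ) * ((A.card + B.card : ℕ) : ℝ))
    (h3 : (1 / 2 : ℝ) * ((A.card + B.card : ℕ) : ℝ) ≤ (B.card : ℝ))
    (h4 : (B.card : ℝ) ≤ p * ((A.card + B.card : ℕ) : ℝ)) :
    A.card + B.card ≤ (n - 1).choose (k - 1) := by
  by_contra! hlt
  obtain ⟨k, rfl⟩ : ∃ k', k = k' + 2 := ⟨k - 2, by omega⟩
  have hn1' : 4 * (k + 2) * (k + 1) + 3 ≤ n := by
    have : 4 * (k + 2) ^ 2 = 4 * (k + 2) * (k + 1) + 4 * (k + 2) := by ring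
    omega
  obtain ⟨n, rfl⟩ : ∃ n', n = n' + 2 := ⟨n - 2, by omega⟩
  have e1 : n + 2 - 1 = n + 1 := by omega
  have e2 : k + 2 - 1 = k + 1 := by omega
  rw [e1, e2] at hlt
  have hstar := Nat.add_one_mul_choose_eq n k
  have hkn : k ≤ n := by nlinarith
  have hN : 0 < n.choose k := Nat.choose_pos hkn
  have hV : (Icc 1 (n + 2)).card = n + 2 := by simp
  have hsum : 4 * (k + 2) * n.choose k < A.card + B.card := by
    refine lt_of_le_of_lt ?_ hlt
    refine Nat.le_of_mul_le_mul_right ?_ (Nat.succ_pos k)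
    rw [← hstar]
    nlinarith
  have hBlarge : 2 * (k + 2) * n.choose k < B.card := by
    have : A.card + B.card ≤ 2 * B.card := by
      have : ((A.card + B.card : ℕ) : ℝ) ≤ ((2 * B.card : ℕ) : ℝ) := by
        push_cast at h3 ⊢; linarith
      exact_mod_cast this
    nlinarith
  have hAlarge : (k + 2 + 1) * n.choose k < A.card := by
    have hp' : 0 < 1 - p := by linarith
    have hn2' : ((k + 2 : ℝ) ^ 2 - 1) ≤ (1 - p) * n := by
      have : ((k + 2 : ℝ) ^ 2 - 1) / (1 - p) ≤ n := by push_cast at hn2; linarith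
      rw [div_le_iff₀ hp'] at this
      linarith
    have hN' : (0 : ℝ) < n.choose k := by exact_mod_cast hN
    have hstar' : ((n : ℝ) + 1) * n.choose k = (n + 1).choose (k + 1) * ((k : ℝ) + 1) := by
      exact_mod_cast hstar
    have hlt' : ((n + 1).choose (k + 1) : ℝ) < ((A.card + B.card : ℕ) : ℝ) := by
      exact_mod_cast hlt
    have hk' : (0 : ℝ) < (k : ℝ) + 1 := by positivity
    have hmain : ((k : ℝ) + 2 + 1) * n.choose k < A.card := by
      refine lt_of_mul_lt_mul_right ?_ hk'.le
      calc ((k : ℝ) + 2 + 1) * n.choose k * (k + 1)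
          = ((k + 2 : ℝ) ^ 2 - 1) * n.choose k := by ring
        _ ≤ (1 - p) * n * n.choose k := by gcongr
        _ < (1 - p) * ((n + 1) * n.choose k) := by nlinarith [mul_pos hp' hN']
        _ = (1 - p) * (n + 1).choose (k + 1) * (k + 1) := by rw [hstar']; ring
        _ ≤ (1 - p) * ((A.card + B.card : ℕ) : ℝ) * (k + 1) := by gcongr
        _ ≤ A.card * (k + 1) := by gcongr
    exact_mod_cast hmain
  have hcross' : ∀ t ∈ B, ∀ s ∈ A, (t ∩ s).Nonempty := fun t ht s hs => by
    rw [inter_comm]; exact hcross s hs t ht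
  have hstar_false : ∀ i, (∀ s ∈ A, i ∈ s) → (∀ t ∈ B, i ∈ t) → False := by
    intro i hiA hiB
    have h := card_le_choose_of_forall_superset (V := Icc 1 (n + 2)) (P := {i}) (F := A ∪ B)
      (fun s hs => (mem_union.1 hs).elim (hA s) (hB s))
      (fun s hs => singleton_subset_iff.2 ((mem_union.1 hs).elim (hiA s) (hiB s)))
    rw [card_union_of_disjoint hdisj, hV, card_singleton, e1, e2] at h
    omega
  have hAcommon : ∀ i, ∃ s ∈ A, i ∉ s := by
    intro i
    by_contra! hi
    by_cases hiB : ∀ t ∈ B, i ∈ t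
    · exact hstar_false i hi hiB
    push Not at hiB
    obtain ⟨t, ht, hit⟩ := hiB
    have h := card_le_of_forall_mem_of_notMem hA (fun t ht => (hB t ht).2) hcross hi ht hit
    rw [hV, Nat.add_sub_cancel, Nat.add_sub_cancel] at h
    nlinarith
  have hBcommon : ∀ i, ∃ t ∈ B, i ∉ t := by
    intro i
    by_contra! hi
    obtain ⟨s, hs, his⟩ := hAcommon i
    have h := card_le_of_forall_mem_of_notMem hB (fun s hs => (hA s hs).2) hcross' hi hs his
    rw [hV, Nat.add_sub_cancel, Nat.add_sub_cancel] at h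
    nlinarith
  obtain ⟨s₀, hs₀⟩ : A.Nonempty := card_pos.1 (by omega)
  obtain ⟨t₀, ht₀⟩ : B.Nonempty := card_pos.1 (by omega)
  obtain ⟨D, hD2, hDk, hD, hDmin⟩ :=
    exists_minimal_cover ⟨s₀, hs₀⟩ hAcommon (fun s hs => hcross s hs t₀ ht₀)
  obtain ⟨E, hE2, hEk, hE, hEmin⟩ :=
    exists_minimal_cover ⟨t₀, ht₀⟩ hBcommon (fun t ht => hcross' t ht s₀ hs₀)
  rw [(hB t₀ ht₀).2] at hDk
  rw [(hA s₀ hs₀).2] at hEk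
  obtain ⟨u, hu⟩ : ∃ u, D.card = u + 2 := ⟨D.card - 2, by omega⟩
  obtain ⟨v, hv⟩ : ∃ v, E.card = v + 2 := ⟨E.card - 2, by omega⟩
  have hn4 : 4 * (k + 2) * k ≤ n := by nlinarith
  have hA4 := four_pow_mul_card_le hV hn4 (by omega) hA (fun t ht => (hB t ht).2) hcross hD
    (hv ▸ hEmin)
  have hB4 := four_pow_mul_card_le hV hn4 (by omega) hB (fun s hs => (hA s hs).2) hcross' hE
    (hu ▸ hDmin)
  rw [hu] at hA4
  rw [hv] at hB4
  have := add_le_of_four_pow_mul_le hN hAlarge.le hBlarge.le (by omega) hA4 hB4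
  omega
end

section
/- For all integers k ≥ 2 and n ≥ 4k² − 4k + 3, we have C(n−1, k−1) > 2k·( C(n−3, k−2) + C(n−2, k−2) ). -/
/-- For `k ≥ 2` and `n ≥ 4k² - 4k + 3`, `C(n-1,k-1) > 2k(C(n-3,k-2) + C(n-2,k-2))`. -/
theorem choose_gt (n k : ℕ) (hk : 2 ≤ k) (hn : 4 * k ^ 2 - 4 * k + 3 ≤ n) :
    2 * k * ((n - 3).choose (k - 2) + (n - 2).choose (k - 2)) < (n - 1).choose (k - 1) := by
  obtain ⟨j, rfl⟩ := Nat.exists_eq_add_of_le' hk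
  obtain ⟨m, rfl⟩ := Nat.exists_eq_add_of_le' (le_trans (Nat.le_add_left 3 _) hn)
  have hm : 4 * (j + 2) * (j + 1) ≤ m := by
    have h : 4 * (j + 2) ^ 2 = 4 * (j + 2) * (j + 1) + 4 * (j + 2) := by ring
    omega
  change 2 * (j + 2) * (m.choose j + (m + 1).choose j) < (m + 2).choose (j + 1)
  have hmono : m.choose j ≤ (m + 1).choose j := Nat.choose_le_choose j (Nat.le_succ m)
  have habs : (m + 2) * (m + 1).choose j = (m + 2).choose (j + 1) * (j + 1) :=
    Nat.add_one_mul_choose_eq (m + 1) j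
  have hpos : 0 < (m + 1).choose j := Nat.choose_pos (by nlinarith)
  refine Nat.lt_of_mul_lt_mul_right (a := j + 1) ?_
  calc 2 * (j + 2) * (m.choose j + (m + 1).choose j) * (j + 1)
      ≤ 2 * (j + 2) * ((m + 1).choose j + (m + 1).choose j) * (j + 1) := by gcongr
    _ = 4 * (j + 2) * (j + 1) * (m + 1).choose j := by ring
    _ < (m + 2) * (m + 1).choose j := by gcongr; omega
    _ = (m + 2).choose (j + 1) * (j + 1) := habs
end

section
/- Let k ≥ 2 and n ≥ 2k + 1 be integers. If Y is a family of (n−k−1)-element subsets of {1,...,n−1} with |Y| ≥ C(n−3, k−2), then the (k−1)-shadow of Y has size at least C(n−3, k−1). -/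
/-- Let `k ≥ 2` and `n ≥ 2k + 1`. If `Y` is a family of `(n-k-1)`-element subsets of
`{1,...,n-1}` with `|Y| ≥ C(n-3,k-2)`, then the `(k-1)`-shadow of `Y` (the family of all
`(k-1)`-element sets contained in some member of `Y`) has size at least `C(n-3,k-1)`. -/
theorem shadow_card_ge (n k : ℕ) (hk : 2 ≤ k) (hn : 2 * k + 1 ≤ n)
    (Y : Finset (Finset ℕ))
    (hY : ∀ y ∈ Y, y ⊆ Finset.Icc 1 (n - 1) ∧ y.card = n - k - 1)
    (hcard : (n - 3).choose (k - 2) ≤ Y.card) :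
    (n - 3).choose (k - 1) ≤
      (((Finset.Icc 1 (n - 1)).powersetCard (k - 1)).filter
        (fun s => ∃ y ∈ Y, s ⊆ y)).card := by
  have map_filter : ∀ y ∈ Y, (Finset.univ.filter fun x : Fin n => (x : ℕ) ∈ y).map
      Fin.valEmbedding = y := by
    intro y hy
    ext x
    simp only [Finset.mem_map, Finset.mem_filter, Finset.mem_univ, true_and,
      Fin.valEmbedding_apply]
    refine ⟨?_, fun hx => ?_⟩
    · rintro ⟨z, hz, rfl⟩
      exact hz
    · have := Finset.mem_Icc.1 ((hY y hy).1 hx)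
      exact ⟨⟨x, by lia⟩, hx, rfl⟩
  set 𝒜 : Finset (Finset (Fin n)) :=
    Y.image fun y => Finset.univ.filter fun x : Fin n => (x : ℕ) ∈ y
  have map_mem : ∀ s ∈ 𝒜, s.map Fin.valEmbedding ∈ Y := by
    intro s hs
    obtain ⟨y, hy, rfl⟩ := Finset.mem_image.1 hs
    rwa [map_filter y hy]
  have card_eq : 𝒜.card = Y.card := Finset.card_image_of_injOn fun y hy z hz hyz => by
    rw [← map_filter y hy, ← map_filter z hz]
    exact congrArg _ hyz
  have sized : (𝒜 : Set (Finset (Fin n))).Sized (n - k - 1) := by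
    intro s hs
    rw [← (hY _ (map_mem s hs)).2, Finset.card_map]
  have lovasz := Finset.kruskal_katona_lovasz_form (i := n - 2 * k) (r := n - k - 1)
    (k := n - 3) (by lia) (by lia) (by lia) sized (by
      rw [card_eq, ← Nat.choose_symm (by lia : n - k - 1 ≤ n - 3)]
      rwa [show n - 3 - (n - k - 1) = k - 2 by lia])
  rw [show n - k - 1 - (n - 2 * k) = k - 1 by lia] at lovasz
  refine lovasz.trans (Finset.card_le_card_of_injOn (Finset.map Fin.valEmbedding) ?_
    (Finset.map_injective _).injOn)
  intro t ht
  have card_t := sized.shadow_iterate ht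
  obtain ⟨s, hs, hts, -⟩ := Finset.mem_shadow_iterate_iff_exists_mem_card_add.1 ht
  have map_sub := Finset.map_subset_map (f := Fin.valEmbedding).2 hts
  refine Finset.mem_filter.2 ⟨Finset.mem_powersetCard.2
    ⟨map_sub.trans (hY _ (map_mem s hs)).1, ?_⟩, _, map_mem s hs, map_sub⟩
  rw [Finset.card_map, card_t]
  lia
end

section
/- Let k ≥ 2 and n ≥ 2k + 1 be integers, and let A and B be cross-intersecting families of k-element subsets of {1,...,n}. If the number of sets in B containing the element n is greater than C(n−3, k−2) + C(n−2, k−2), then the number of sets in A not containing the element n is at most C(n−3, k−2). -/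
open Finset FinsetFamily in
/-- If `A` is at least as large as a full level `powersetCard (m - a) _` of a `q`-element set, then
a family `B` cross-intersecting with `A` misses at least `C(q, b)` of the `b`-element subsets. -/
theorem card_add_choose_le_of_cross_intersecting_fin {m a b q : ℕ} {A B : Finset (Finset (Fin m))}
    (hA : (A : Set (Finset (Fin m))).Sized a) (hB : (B : Set (Finset (Fin m))).Sized b)
    (hcross : ∀ s ∈ A, ∀ t ∈ B, (s ∩ t).Nonempty) (hab : a + b ≤ m) (hq : m - a ≤ q) (hqm : q ≤ m)
    (hcard : q.choose (m - a) ≤ #A) : #B + q.choose b ≤ m.choose b := by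
  have hAc : (Aᶜˢ : Set (Finset (Fin m))).Sized (m - a) := by
    simpa using hA.compls
  have hkk := kruskal_katona_lovasz_form (i := m - a - b) (Nat.sub_le _ _) hq hqm hAc
    (by simpa using hcard)
  rw [Nat.sub_sub_self (by omega)] at hkk
  have hsh := hAc.shadow_iterate (k := m - a - b)
  rw [Nat.sub_sub_self (by omega)] at hsh
  have hdisj : Disjoint B (∂^[m - a - b] Aᶜˢ) := by
    rw [disjoint_left]
    intro t ht hts
    obtain ⟨s, hs, hst, -⟩ := mem_shadow_iterate_iff_exists_sdiff.1 hts
    obtain ⟨x, hx⟩ := hcross _ (mem_compls.1 hs) t ht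
    rw [mem_inter, mem_compl] at hx
    exact hx.1 (hst hx.2)
  have hsized : ((B ∪ ∂^[m - a - b] Aᶜˢ : Finset _) : Set (Finset (Fin m))).Sized b := by
    rw [coe_union, Set.sized_union]
    exact ⟨hB, hsh⟩
  have hle := hsized.card_le
  rw [card_union_of_disjoint hdisj, Fintype.card_fin] at hle
  omega

open Finset in
/-- The version of `card_add_choose_le_of_cross_intersecting_fin` for families of subsets of a
finite set `X`. -/
theorem card_add_choose_le_of_cross_intersecting_s13 {α : Type*} [DecidableEq α] {X : Finset α}
    {a b q : ℕ} {A B : Finset (Finset α)} (hA : A ⊆ X.powersetCard a) (hB : B ⊆ X.powersetCard b)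
    (hcross : ∀ s ∈ A, ∀ t ∈ B, (s ∩ t).Nonempty) (hab : a + b ≤ #X) (hq : #X - a ≤ q)
    (hqm : q ≤ #X) (hcard : q.choose (#X - a) ≤ #A) : #B + q.choose b ≤ (#X).choose b := by
  obtain ⟨f, hf⟩ : ∃ f : Fin #X ↪ α, univ.map f = X :=
    ⟨X.equivFin.symm.toEmbedding.trans (.subtype _), by
      rw [← map_map, map_univ_equiv]; exact X.attach_map_val⟩
  let p (s : Finset α) : Finset (Fin #X) := s.preimage f f.injective.injOn
  have hp {s : Finset α} (hs : s ⊆ X) : (p s).map f = s := by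
    rw [← hf] at hs
    obtain ⟨u, -, rfl⟩ := subset_map_iff.1 hs
    simp [p, preimage_map]
  have hinj {F : Finset (Finset α)} {c : ℕ} (hF : F ⊆ X.powersetCard c) : #(F.image p) = #F := by
    refine card_image_of_injOn fun s hs t ht hst => ?_
    rw [← hp (mem_powersetCard.1 (hF hs)).1, ← hp (mem_powersetCard.1 (hF ht)).1, hst]
  have hsized {F : Finset (Finset α)} {c : ℕ} (hF : F ⊆ X.powersetCard c) :
      (F.image p : Set (Finset (Fin #X))).Sized c := by
    intro u hu
    obtain ⟨s, hs, rfl⟩ := mem_image.1 (mem_coe.1 hu)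
    obtain ⟨hsX, hsc⟩ := mem_powersetCard.1 (hF hs)
    rw [← card_map f, hp hsX, hsc]
  rw [← hinj hB]
  refine card_add_choose_le_of_cross_intersecting_fin (hsized hA) (hsized hB) ?_ hab hq hqm
    (by rwa [hinj hA])
  simp only [forall_mem_image]
  intro s hs t ht
  rw [← map_nonempty (f := f), map_inter, hp (mem_powersetCard.1 (hA hs)).1,
    hp (mem_powersetCard.1 (hB ht)).1]
  exact hcross s hs t ht

/-- Let `k ≥ 2` and `n ≥ 2k + 1`, and let `A`, `B` be cross-intersecting families of
`k`-element subsets of `{1,...,n}`. If more than `C(n-3,k-2) + C(n-2,k-2)` members of `B`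
contain the element `n`, then at most `C(n-3,k-2)` members of `A` avoid the element `n`. -/
theorem card_not_mem_le_of_cross_intersecting (n k : ℕ) (hk : 2 ≤ k) (hn : 2 * k + 1 ≤ n)
    (A B : Finset (Finset ℕ))
    (hA : ∀ s ∈ A, s ⊆ Finset.Icc 1 n ∧ s.card = k)
    (hB : ∀ t ∈ B, t ⊆ Finset.Icc 1 n ∧ t.card = k)
    (hcross : ∀ s ∈ A, ∀ t ∈ B, (s ∩ t).Nonempty)
    (hBn : (n - 3).choose (k - 2) + (n - 2).choose (k - 2) <
      (B.filter (fun t => n ∈ t)).card) :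
    (A.filter (fun s => n ∉ s)).card ≤ (n - 3).choose (k - 2) := by
  by_contra! hlt
  have hX : ((Finset.Icc 1 n).erase n).card = n - 1 := by
    rw [Finset.card_erase_of_mem (by simp; omega)]; simp
  have hinj : ((B.filter (fun t => n ∈ t)).image (fun t => t.erase n)).card =
      (B.filter (fun t => n ∈ t)).card := by
    refine Finset.card_image_of_injOn fun s hs t ht hst => ?_
    simp only [Finset.coe_filter, Set.mem_ofPred_eq] at hs ht
    rw [← Finset.insert_erase hs.2, ← Finset.insert_erase ht.2]
    exact congrArg _ hst
  have hmain := card_add_choose_le_of_cross_intersecting_s13 (X := (Finset.Icc 1 n).erase n)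
    (a := k) (b := k - 1) (q := n - 3) (A := A.filter (fun s => n ∉ s))
    (B := (B.filter (fun t => n ∈ t)).image (fun t => t.erase n))
    (by
      intro s hs
      rw [Finset.mem_filter] at hs
      exact Finset.mem_powersetCard.2
        ⟨Finset.subset_erase.2 ⟨(hA s hs.1).1, hs.2⟩, (hA s hs.1).2⟩)
    (by
      simp only [Finset.image_subset_iff, Finset.mem_filter, Finset.mem_powersetCard]
      rintro t ⟨ht, hnt⟩
      exact ⟨Finset.erase_subset_erase _ (hB t ht).1, by
        rw [Finset.card_erase_of_mem hnt, (hB t ht).2]⟩)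
    (by
      simp only [Finset.forall_mem_image, Finset.mem_filter]
      rintro s ⟨hs, hns⟩ t ⟨ht, -⟩
      obtain ⟨x, hx⟩ := hcross s hs t ht
      rw [Finset.mem_inter] at hx
      exact ⟨x, Finset.mem_inter.2
        ⟨hx.1, Finset.mem_erase.2 ⟨fun h => hns (h ▸ hx.1), hx.2⟩⟩⟩)
    (by omega) (by omega) (by omega)
    (by
      rw [hX, ← Nat.choose_symm (by omega), show n - 3 - (n - 1 - k) = k - 2 by omega]
      exact hlt.le)
  rw [hinj, hX] at hmain
  obtain ⟨j, rfl⟩ : ∃ j, k = j + 2 := ⟨k - 2, by omega⟩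
  obtain ⟨l, rfl⟩ : ∃ l, n = l + 3 := ⟨n - 3, by omega⟩
  have h₁ : (l + 2).choose (j + 1) = (l + 1).choose j + (l + 1).choose (j + 1) :=
    Nat.choose_succ_succ _ _
  have h₂ : (l + 1).choose (j + 1) = l.choose j + l.choose (j + 1) := Nat.choose_succ_succ _ _
  simp only [show l + 3 - 1 = l + 2 by omega, show l + 3 - 2 = l + 1 by omega,
    Nat.add_sub_cancel, show j + 2 - 1 = j + 1 by omega] at hmain hBn
  omega
end

section
/- Let k ≥ 2 be an integer, let p ∈ [2/3, 1), and let n be an integer with n > (k² − 1)/(1 − p) + 1. Let A and B be cross-intersecting families of k-element subsets of {1,...,n} such that |A| ≥ (1−p)·C(n−1, k−1) and the number of sets in A containing the element n is at least (k/(k+1))·|A|. Then every set in B contains the element n. -/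
/-- At most `C(|s| - |u|, k - |u|)` of the `k`-element subsets of `s` contain a fixed `u ⊆ s`. -/
theorem card_filter_superset_powersetCard_le {α : Type*} [DecidableEq α] {s u : Finset α}
    (hu : u ⊆ s) (k : ℕ) :
    ((s.powersetCard k).filter (fun v => u ⊆ v)).card ≤
      (s.card - u.card).choose (k - u.card) := by
  rw [← Finset.card_sdiff_of_subset hu, ← Finset.card_powersetCard]
  refine Finset.card_le_card_of_injOn (fun v => v \ u) ?_ ?_
  · intro v hv
    simp only [Finset.coe_filter, Finset.mem_powersetCard, Set.mem_ofPred_eq] at hv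
    simp only [Finset.mem_coe, Finset.mem_powersetCard]
    exact ⟨Finset.sdiff_subset_sdiff hv.1.1 subset_rfl,
      by rw [Finset.card_sdiff_of_subset hv.2, hv.1.2]⟩
  · intro v hv w hw h
    simp only [Finset.coe_filter, Set.mem_ofPred_eq] at hv hw
    rw [← Finset.sdiff_union_of_subset hv.2, ← Finset.sdiff_union_of_subset hw.2]
    exact congrArg (· ∪ u) h

/-- Among `k`-element subsets of `s` that all meet `t ⊆ s`, at most `|t|·C(|s| - 2, k - 2)`
contain a fixed element `a ∈ s` outside `t`. -/
theorem card_filter_mem_le_of_inter_nonempty {α : Type*} [DecidableEq α] {s t : Finset α}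
    {a : α} {k : ℕ} {A : Finset (Finset α)} (hA : A ⊆ s.powersetCard k) (ht : t ⊆ s)
    (has : a ∈ s) (hat : a ∉ t) (hmeet : ∀ v ∈ A, (v ∩ t).Nonempty) :
    (A.filter (fun v => a ∈ v)).card ≤ t.card * (s.card - 2).choose (k - 2) := by
  have hsub : A.filter (fun v => a ∈ v) ⊆
      t.biUnion (fun x => (s.powersetCard k).filter (fun v => {a, x} ⊆ v)) := by
    intro v hv
    obtain ⟨hvA, hav⟩ := Finset.mem_filter.1 hv
    obtain ⟨x, hx⟩ := hmeet v hvA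
    obtain ⟨hxv, hxt⟩ := Finset.mem_inter.1 hx
    exact Finset.mem_biUnion.2 ⟨x, hxt, Finset.mem_filter.2
      ⟨hA hvA, Finset.insert_subset hav (Finset.singleton_subset_iff.2 hxv)⟩⟩
  refine (Finset.card_le_card hsub).trans (Finset.card_biUnion_le_card_mul _ _ _ fun x hx => ?_)
  have hax : a ≠ x := fun h => hat (h ▸ hx)
  have h := card_filter_superset_powersetCard_le
    (Finset.insert_subset has (Finset.singleton_subset_iff.2 (ht hx))) k
  rwa [Finset.card_pair hax] at h

/-- Let `k ≥ 2`, `p ∈ [2/3,1)` and `n > (k² - 1)/(1-p) + 1`. Let `A`, `B` be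
cross-intersecting families of `k`-element subsets of `{1,...,n}` such that
`|A| ≥ (1-p)·C(n-1,k-1)` and at least `(k/(k+1))·|A|` members of `A` contain the
element `n`. Then every member of `B` contains the element `n`. -/
theorem mem_of_cross_intersecting (n k : ℕ) (p : ℝ) (hk : 2 ≤ k)
    (hp : 2 / 3 ≤ p) (hp1 : p < 1)
    (hn : ((k : ℝ) ^ 2 - 1) / (1 - p) + 1 < (n : ℝ))
    (A B : Finset (Finset ℕ))
    (hA : ∀ s ∈ A, s ⊆ Finset.Icc 1 n ∧ s.card = k)
    (hB : ∀ t ∈ B, t ⊆ Finset.Icc 1 n ∧ t.card = k)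
    (hcross : ∀ s ∈ A, ∀ t ∈ B, (s ∩ t).Nonempty)
    (hAcard : (1 - p) * (((n - 1).choose (k - 1) : ℕ) : ℝ) ≤ (A.card : ℝ))
    (hAn : (k : ℝ) / ((k : ℝ) + 1) * (A.card : ℝ) ≤
      ((A.filter (fun s => n ∈ s)).card : ℝ)) :
    ∀ t ∈ B, n ∈ t := by
  intro t ht
  by_contra hnt
  obtain ⟨hts, htk⟩ := hB t ht
  have hk2 : (2 : ℝ) ≤ k := by exact_mod_cast hk
  have hq : 0 < 1 - p := by linarith
  have hn' : (k : ℝ) ^ 2 - 1 < ((n : ℝ) - 1) * (1 - p) := by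
    rw [← div_lt_iff₀ hq]
    linarith
  have hkn' : (k : ℝ) < n := by nlinarith
  have hkn : k < n := by exact_mod_cast hkn'
  have hcard := card_filter_mem_le_of_inter_nonempty (s := Finset.Icc 1 n) (k := k)
    (fun s hs => Finset.mem_powersetCard.2 (hA s hs)) hts
    (Finset.mem_Icc.2 ⟨by omega, le_rfl⟩) hnt (fun s hs => hcross s hs t ht)
  rw [htk, Nat.card_Icc, Nat.add_sub_cancel] at hcard
  obtain ⟨m, rfl⟩ : ∃ m, n = m + 2 := ⟨n - 2, by omega⟩
  obtain ⟨j, rfl⟩ : ∃ j, k = j + 2 := ⟨k - 2, by omega⟩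
  have hchoose : ((m : ℝ) + 1) * (m.choose j : ℝ) =
      ((m + 1).choose (j + 1) : ℝ) * ((j : ℝ) + 1) := by
    exact_mod_cast Nat.add_one_mul_choose_eq m j
  have hpos : (0 : ℝ) < ((m + 1).choose (j + 1) : ℝ) := by
    exact_mod_cast Nat.choose_pos (by omega)
  have hcard' := hAn.trans (Nat.cast_le (α := ℝ).2 hcard)
  simp only [Nat.add_sub_cancel, show m + 2 - 1 = m + 1 from rfl,
    show j + 2 - 1 = j + 1 from rfl] at hAcard hcard'
  push_cast at hcard' hn' hk2
  set c : ℝ := ((m + 1).choose (j + 1) : ℝ)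
  have hsmall : (A.card : ℝ) ≤ ((j : ℝ) + 3) * (m.choose j : ℝ) := by
    rw [div_mul_eq_mul_div, div_le_iff₀ (by positivity)] at hcard'
    refine le_of_mul_le_mul_left ?_ (show (0 : ℝ) < (j : ℝ) + 2 by positivity)
    linarith
  have hle : ((1 - p) * ((m : ℝ) + 1)) * c ≤ (((j : ℝ) + 3) * ((j : ℝ) + 1)) * c := by
    calc ((1 - p) * ((m : ℝ) + 1)) * c = ((m : ℝ) + 1) * ((1 - p) * c) := by ring
      _ ≤ ((m : ℝ) + 1) * (((j : ℝ) + 3) * (m.choose j : ℝ)) :=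
        mul_le_mul_of_nonneg_left (hAcard.trans hsmall) (by positivity)
      _ = ((j : ℝ) + 3) * (((m : ℝ) + 1) * (m.choose j : ℝ)) := by ring
      _ = (((j : ℝ) + 3) * ((j : ℝ) + 1)) * c := by rw [hchoose]; ring
  have := le_of_mul_le_mul_right hle hpos
  linarith
end

section
/- Let k ≥ 2 be an integer, let p ∈ [2/3, 1), and let n ≥ (k² − 1)/(1 − p) + 2. Let A be a family of k-element subsets of {1,...,n} with |A| ≥ (1−p)·C(n−1, k−1), and suppose the number of sets in A not containing the element n is at most C(n−3, k−2). Then the number of sets in A containing the element n is at least (k/(k+1))·|A|. -/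
/-- Let `k ≥ 2`, `p ∈ [2/3,1)` and `n ≥ (k² - 1)/(1-p) + 2`. If `A` is a family of
`k`-element subsets of `{1,...,n}` with `|A| ≥ (1-p)·C(n-1,k-1)` and at most
`C(n-3,k-2)` members of `A` avoid the element `n`, then at least `(k/(k+1))·|A|`
members of `A` contain the element `n`. -/
theorem card_mem_ge (n k : ℕ) (p : ℝ) (hk : 2 ≤ k)
    (hp : 2 / 3 ≤ p) (hp1 : p < 1)
    (hn : ((k : ℝ) ^ 2 - 1) / (1 - p) + 2 ≤ (n : ℝ))
    (A : Finset (Finset ℕ))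
    (hA : ∀ s ∈ A, s ⊆ Finset.Icc 1 n ∧ s.card = k)
    (hAcard : (1 - p) * (((n - 1).choose (k - 1) : ℕ) : ℝ) ≤ (A.card : ℝ))
    (hAnot : (A.filter (fun s => n ∉ s)).card ≤ (n - 3).choose (k - 2)) :
    (k : ℝ) / ((k : ℝ) + 1) * (A.card : ℝ) ≤
      ((A.filter (fun s => n ∈ s)).card : ℝ) := by
  have hq : 0 < 1 - p := by linarith
  have hk' : (2 : ℝ) ≤ k := by exact_mod_cast hk
  have hsq : (k : ℝ) ^ 2 - 1 ≤ (1 - p) * ((n : ℝ) - 2) := by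
    rw [← div_le_iff₀' hq]
    linarith
  have hn2 : 2 ≤ n := by
    have : 0 ≤ ((k : ℝ) ^ 2 - 1) / (1 - p) := div_nonneg (by nlinarith) hq.le
    exact_mod_cast (by linarith : (2 : ℝ) ≤ n)
  have hsplit := A.card_filter_add_card_filter_not (fun s => n ∈ s)
  obtain ⟨m, rfl⟩ := Nat.exists_eq_add_of_le' hn2
  obtain ⟨j, rfl⟩ := Nat.exists_eq_add_of_le' hk
  have habsorb := Nat.add_one_mul_choose_eq m j
  have hmono : (m + 2 - 3).choose (j + 2 - 2) ≤ m.choose j :=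
    Nat.choose_le_choose j (by omega)
  have havoid := hAnot.trans hmono
  simp only [Nat.add_succ_sub_one] at hAcard
  have hsplitR : ((A.filter (fun s => m + 2 ∈ s)).card : ℝ) +
      (A.filter (fun s => m + 2 ∉ s)).card = A.card := by exact_mod_cast hsplit
  have habsorbR : ((m : ℝ) + 1) * (m.choose j : ℝ) =
      ((m + 1).choose (j + 1) : ℝ) * ((j : ℝ) + 1) := by exact_mod_cast habsorb
  have havoidR : ((A.filter (fun s => m + 2 ∉ s)).card : ℝ) ≤ (m.choose j : ℝ) := by
    exact_mod_cast havoid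
  push_cast at hsq ⊢
  have hchoose : ((j : ℝ) + 3) * (m.choose j : ℝ) ≤
      (1 - p) * ((m + 1).choose (j + 1) : ℝ) := by
    have hj : (0 : ℝ) < (j : ℝ) + 1 := by positivity
    refine le_of_mul_le_mul_right ?_ hj
    calc ((j : ℝ) + 3) * (m.choose j : ℝ) * ((j : ℝ) + 1)
        = (((j : ℝ) + 2) ^ 2 - 1) * (m.choose j : ℝ) := by ring
      _ ≤ ((1 - p) * ((m : ℝ) + 1)) * (m.choose j : ℝ) := by
        gcongr
        linarith
      _ = (1 - p) * ((m + 1).choose (j + 1) : ℝ) * ((j : ℝ) + 1) := by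
        rw [mul_assoc, habsorbR, mul_assoc]
  have hscaled := mul_le_mul_of_nonneg_left havoidR (by positivity : (0 : ℝ) ≤ (j : ℝ) + 3)
  rw [div_mul_eq_mul_div, div_le_iff₀ (by positivity)]
  linear_combination hscaled + hchoose + hAcard - ((j : ℝ) + 3) * hsplitR
end
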